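/- arXiv:math/0507525 — 3 statements merged into one kernel-verified Lean document; each statement's English description precedes it below -/
import Mathlib

section
/- Let K be an algebraic number field and let P : K² → K² be a polynomial map with J(P) identically equal to 1. Then P is injective for almost all rational integers of K: there exists a set S ⊆ ℤ² containing almost all rational integers (i.e., |(ℤ² ∩ [-N,N]²) \ S| = o(N²) as N → ∞) such that for all (x,y) ∈ S and (x',y') ∈ S, P(x,y) = P(x',y') implies (x,y) = (x',y'). -/
open MvPolynomial

theorem jm_taylor {R : Type*} [CommRing R] (f : MvPolynomial (Fin 2) R) :
    ∃ G0 G1 : R → R → R → R → R, ∀ x y x' y' : R,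
      (eval ![x', y'] f - eval ![x, y] f = G0 x y x' y' * (x' - x) + G1 x y x' y' * (y' - y)) ∧
      (∀ m : R, m ∣ x' - x → m ∣ y' - y →
        m ∣ G0 x y x' y' - eval ![x, y] (pderiv 0 f) ∧
        m ∣ G1 x y x' y' - eval ![x, y] (pderiv 1 f)) := by
  induction f using MvPolynomial.induction_on with
  | C a => exact ⟨fun _ _ _ _ => 0, fun _ _ _ _ => 0, fun x y x' y' => by simp⟩
  | add p q hp hq =>
    obtain ⟨A0, A1, hA⟩ := hp
    obtain ⟨B0, B1, hB⟩ := hq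
    refine ⟨fun x y x' y' => A0 x y x' y' + B0 x y x' y',
      fun x y x' y' => A1 x y x' y' + B1 x y x' y', fun x y x' y' => ⟨?_, ?_⟩⟩
    · have h1 := (hA x y x' y').1
      have h2 := (hB x y x' y').1
      simp only [map_add]
      linear_combination h1 + h2
    · intro m hx hy
      obtain ⟨h1, h2⟩ := (hA x y x' y').2 m hx hy
      obtain ⟨h3, h4⟩ := (hB x y x' y').2 m hx hy
      simp only [map_add]
      refine ⟨?_, ?_⟩
      · convert dvd_add h1 h3 using 1; ring
      · convert dvd_add h2 h4 using 1; ring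
  | mul_X p i hp =>
    obtain ⟨A0, A1, hA⟩ := hp
    fin_cases i
    · refine ⟨fun x y x' y' => A0 x y x' y' * x' + eval ![x, y] p,
        fun x y x' y' => A1 x y x' y' * x', fun x y x' y' => ⟨?_, ?_⟩⟩
      · have h1 := (hA x y x' y').1
        simp
        linear_combination x' * h1
      · intro m hx hy
        obtain ⟨h1, h2⟩ := (hA x y x' y').2 m hx hy
        refine ⟨?_, ?_⟩
        · convert dvd_add (h1.mul_right x') (hx.mul_left (eval ![x, y] (pderiv 0 p))) using 1
          simp [pderiv_mul]; ring
        · convert dvd_add (h2.mul_right x') (hx.mul_left (eval ![x, y] (pderiv 1 p))) using 1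
          simp [pderiv_mul, pderiv_X]; ring
    · refine ⟨fun x y x' y' => A0 x y x' y' * y',
        fun x y x' y' => A1 x y x' y' * y' + eval ![x, y] p, fun x y x' y' => ⟨?_, ?_⟩⟩
      · have h1 := (hA x y x' y').1
        simp
        linear_combination y' * h1
      · intro m hx hy
        obtain ⟨h1, h2⟩ := (hA x y x' y').2 m hx hy
        refine ⟨?_, ?_⟩
        · convert dvd_add (h1.mul_right y') (hy.mul_left (eval ![x, y] (pderiv 0 p))) using 1
          simp [pderiv_mul, pderiv_X]; ring
        · convert dvd_add (h2.mul_right y') (hy.mul_left (eval ![x, y] (pderiv 1 p))) using 1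
          simp [pderiv_mul]; ring

theorem jm_curve_deriv {K : Type*} [Field K] (f : MvPolynomial (Fin 2) K)
    (c d : Polynomial K) :
    Polynomial.derivative (aeval ![c, d] f) =
      aeval ![c, d] (pderiv 0 f) * Polynomial.derivative c +
      aeval ![c, d] (pderiv 1 f) * Polynomial.derivative d := by
  induction f using MvPolynomial.induction_on with
  | C a => simp [Polynomial.algebraMap_eq]
  | add p q hp hq => simp only [map_add, hp, hq]; ring
  | mul_X p i hp =>
    fin_cases i <;> simp [pderiv_mul, pderiv_X, hp] <;> ring

theorem jm_eval_curve {K : Type*} [Field K] (f : MvPolynomial (Fin 2) K)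
    (c d : Polynomial K) (t : K) :
    Polynomial.eval t (aeval ![c, d] f) = eval ![c.eval t, d.eval t] f := by
  induction f using MvPolynomial.induction_on with
  | C a => simp [Polynomial.algebraMap_eq]
  | add p q hp hq => simp only [map_add, hp, hq, Polynomial.eval_add]
  | mul_X p i hp =>
    fin_cases i <;> simp [hp]

theorem jm_curve {K : Type*} [Field K] [CharZero K] (f : MvPolynomial (Fin 2) K)
    (c d c' d' : Polynomial K)
    (h : ∀ n : ℕ, eval ![c.eval (n : K), d.eval (n : K)] f
      = eval ![c'.eval (n : K), d'.eval (n : K)] f) :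
    eval ![c.eval 0, d.eval 0] (pderiv 0 f) * c.derivative.eval 0 +
    eval ![c.eval 0, d.eval 0] (pderiv 1 f) * d.derivative.eval 0 =
    eval ![c'.eval 0, d'.eval 0] (pderiv 0 f) * c'.derivative.eval 0 +
    eval ![c'.eval 0, d'.eval 0] (pderiv 1 f) * d'.derivative.eval 0 := by
  have key : aeval ![c, d] f = aeval ![c', d'] f := by
    apply Polynomial.eq_of_infinite_eval_eq
    apply Set.Infinite.mono (s := Set.range (fun n : ℕ => (n : K)))
    · rintro _ ⟨n, rfl⟩
      simp only [Set.mem_ofPred_eq, jm_eval_curve]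
      exact h n
    · exact Set.infinite_range_of_injective Nat.cast_injective
  have h2 := congrArg (fun P => (Polynomial.derivative P).eval 0) key
  simpa only [jm_curve_deriv, Polynomial.eval_add, Polynomial.eval_mul, jm_eval_curve] using h2

/-- no nontrivial affine symmetries -/
theorem jm_affine {K : Type*} [Field K] [CharZero K] (f g : MvPolynomial (Fin 2) K)
    (hJ : pderiv 0 f * pderiv 1 g - pderiv 1 f * pderiv 0 g = 1)
    (a b c d w z : K)
    (hf : ∀ x y, eval ![a * x + b * y + w, c * x + d * y + z] f = eval ![x, y] f)
    (hg : ∀ x y, eval ![a * x + b * y + w, c * x + d * y + z] g = eval ![x, y] g)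
    (x₀ y₀ : K) : a * x₀ + b * y₀ + w = x₀ ∧ c * x₀ + d * y₀ + z = y₀ := by
  have hJe : ∀ x y : K, eval ![x, y] (pderiv 0 f) * eval ![x, y] (pderiv 1 g)
      - eval ![x, y] (pderiv 1 f) * eval ![x, y] (pderiv 0 g) = 1 := by
    intro x y
    simpa using congrArg (eval ![x, y]) hJ
  have chain : ∀ h : MvPolynomial (Fin 2) K,
      (∀ x y, eval ![a * x + b * y + w, c * x + d * y + z] h = eval ![x, y] h) →
      ∀ x y : K,
        eval ![a * x + b * y + w, c * x + d * y + z] (pderiv 0 h) * a +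
        eval ![a * x + b * y + w, c * x + d * y + z] (pderiv 1 h) * c = eval ![x, y] (pderiv 0 h) ∧
        eval ![a * x + b * y + w, c * x + d * y + z] (pderiv 0 h) * b +
        eval ![a * x + b * y + w, c * x + d * y + z] (pderiv 1 h) * d
          = eval ![x, y] (pderiv 1 h) := by
    intro h hh x y
    have e1 := jm_curve h
      (Polynomial.C a * (Polynomial.C x + Polynomial.X) + Polynomial.C b * Polynomial.C y
        + Polynomial.C w)
      (Polynomial.C c * (Polynomial.C x + Polynomial.X) + Polynomial.C d * Polynomial.C y
        + Polynomial.C z) (Polynomial.C x + Polynomial.X) (Polynomial.C y)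
      (by intro n; simpa using hh (x + n) y)
    have e2 := jm_curve h
      (Polynomial.C a * Polynomial.C x + Polynomial.C b * (Polynomial.C y + Polynomial.X)
        + Polynomial.C w)
      (Polynomial.C c * Polynomial.C x + Polynomial.C d * (Polynomial.C y + Polynomial.X)
        + Polynomial.C z) (Polynomial.C x) (Polynomial.C y + Polynomial.X)
      (by intro n; simpa using hh x (y + n))
    simp at e1 e2
    exact ⟨e1, e2⟩
  have hdet : a * d - b * c = 1 := by
    obtain ⟨h1, h2⟩ := chain f hf 0 0
    obtain ⟨h3, h4⟩ := chain g hg 0 0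
    have h5 := hJe 0 0
    have h6 := hJe (a * 0 + b * 0 + w) (c * 0 + d * 0 + z)
    rw [← h1, ← h2, ← h3, ← h4] at h5
    linear_combination h5 - (a * d - b * c) * h6
  by_cases hN : (a - 1) * (d - 1) - b * c = 0
  · skip
    have htr : a + d = 2 := by linear_combination hdet - hN
    set s := a * x₀ + b * y₀ + w - x₀ with hs
    set r := c * x₀ + d * y₀ + z - y₀ with hr
    set s' := (a - 1) * s + b * r with hs'
    set r' := c * s + (d - 1) * r with hr'
    have e1 : (a - 1) * s' + b * r' = 0 := by
      rw [hs', hr']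
      linear_combination (a * s + b * r - s) * htr - s * hN
    have e2 : c * s' + (d - 1) * r' = 0 := by
      rw [hs', hr']
      linear_combination (c * s + d * r - r) * htr - r * hN
    have iter : ∀ h : MvPolynomial (Fin 2) K,
      (∀ x y, eval ![a * x + b * y + w, c * x + d * y + z] h = eval ![x, y] h) →
      ∀ n : ℕ, eval ![x₀ + n * s + n * (n - 1) / 2 * s', y₀ + n * r + n * (n - 1) / 2 * r'] h
        = eval ![x₀, y₀] h := by
      intro h hh n
      induction n with
      | zero => simp
      | succ n ih =>
        rw [← ih, ← hh (x₀ + n * s + n * (n - 1) / 2 * s')]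
        congr 3
        · push_cast
          linear_combination (-(n : K) * (n - 1) / 2) * e1 
        · congr 1
          push_cast
          linear_combination (-(n : K) * (n - 1) / 2) * e2 
    have fin : ∀ h : MvPolynomial (Fin 2) K,
      (∀ x y, eval ![a * x + b * y + w, c * x + d * y + z] h = eval ![x, y] h) →
        eval ![x₀, y₀] (pderiv 0 h) * (s - s' / 2) + eval ![x₀, y₀] (pderiv 1 h) * (r - r' / 2)
          = 0 := by
      intro h hh
      have := jm_curve h
        (Polynomial.C x₀ + Polynomial.X * Polynomial.C s
          + Polynomial.X * (Polynomial.X - 1) * Polynomial.C (s' / 2))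
        (Polynomial.C y₀ + Polynomial.X * Polynomial.C r
          + Polynomial.X * (Polynomial.X - 1) * Polynomial.C (r' / 2))
        (Polynomial.C x₀) (Polynomial.C y₀)
        (by
          intro n
          have := iter h hh n
          simp only [Polynomial.eval_add, Polynomial.eval_C, Polynomial.eval_mul, Polynomial.eval_X,
            Polynomial.eval_sub, Polynomial.eval_one]
          rw [← this]
          congr 3
          · ring
          · congr 1
            ring)
      simp at this
      linear_combination this
    have f1 := fin f hf
    have f2 := fin g hg
    have f3 := hJe x₀ y₀
    have g1 : s - s' / 2 = 0 := by
      linear_combination (-(s - s' / 2)) * f3 + eval ![x₀, y₀] (pderiv 1 g) * f1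
        - eval ![x₀, y₀] (pderiv 1 f) * f2
    have g2 : r - r' / 2 = 0 := by
      linear_combination (-(r - r' / 2)) * f3 - eval ![x₀, y₀] (pderiv 0 g) * f1
        + eval ![x₀, y₀] (pderiv 0 f) * f2
    have g3 : s' = 0 := by
      linear_combination hs' + (a - 1) * g1 + b * g2 + e1 / 2
    have g4 : r' = 0 := by
      linear_combination hr' + c * g1 + (d - 1) * g2 + e2 / 2
    have g5 : s = 0 := by linear_combination g1 + g3 / 2
    have g6 : r = 0 := by linear_combination g2 + g4 / 2
    exact ⟨sub_eq_zero.mp g5, sub_eq_zero.mp g6⟩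
  · exfalso
    set D := (a - 1) * (d - 1) - b * c with hD
    have hx : a * ((b * z - (d - 1) * w) / D) + b * ((c * w - (a - 1) * z) / D) + w
        = (b * z - (d - 1) * w) / D := by
      field_simp
      rw [hD]; ring
    have hy : c * ((b * z - (d - 1) * w) / D) + d * ((c * w - (a - 1) * z) / D) + z
        = (c * w - (a - 1) * z) / D := by
      field_simp
      rw [hD]; ring
    obtain ⟨h1, h2⟩ := chain f hf ((b * z - (d - 1) * w) / D) ((c * w - (a - 1) * z) / D)
    obtain ⟨h3, h4⟩ := chain g hg ((b * z - (d - 1) * w) / D) ((c * w - (a - 1) * z) / D)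
    have h5 := hJe ((b * z - (d - 1) * w) / D) ((c * w - (a - 1) * z) / D)
    rw [hx, hy] at h1 h2 h3 h4
    generalize eval ![(b * z - (d - 1) * w) / D, (c * w - (a - 1) * z) / D] (pderiv 0 f) = p at *
    generalize eval ![(b * z - (d - 1) * w) / D, (c * w - (a - 1) * z) / D] (pderiv 1 f) = q at *
    generalize eval ![(b * z - (d - 1) * w) / D, (c * w - (a - 1) * z) / D] (pderiv 0 g) = p' at *
    generalize eval ![(b * z - (d - 1) * w) / D, (c * w - (a - 1) * z) / D] (pderiv 1 g) = q' at *
    have a1 : a - 1 = 0 := by linear_combination (-(a - 1)) * h5 + q' * h1 - q * h3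
    have b1 : b = 0 := by linear_combination (-b) * h5 + q' * h2 - q * h4
    have d1 : d - 1 = 0 := by linear_combination (-(d - 1)) * h5 - p' * h2 + p * h4
    apply hN
    rw [hD, a1, b1]; ring

theorem jm_valuation {K : Type*} [Field K] [NumberField K] (s : Finset K) :
    ∃ (V : ValuationSubring K) (p : ℕ), p.Prime ∧ (∀ c ∈ s, c ∈ V) ∧ ¬ IsUnit (p : V) := by
  classical
  have h1 : ∃ d : ℤ, d ≠ 0 ∧ ∀ c ∈ s, IsIntegral ℤ ((d : K) * c) := by
    induction s using Finset.induction_on with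
    | empty => exact ⟨1, by simp, by simp⟩
    | insert x s hx ih =>
      obtain ⟨d, hd, h⟩ := ih
      have hx : IsAlgebraic ℤ x :=
        (IsFractionRing.isAlgebraic_iff ℤ ℚ K).mpr (Algebra.IsAlgebraic.isAlgebraic x)
      obtain ⟨y, hy, hy'⟩ := hx.exists_integral_multiple
      refine ⟨d * y, mul_ne_zero hd hy, ?_⟩
      intro c hc
      have hint : ∀ n : ℤ, IsIntegral ℤ (n : K) := fun n => by
        simpa using (isIntegral_algebraMap (R := ℤ) (A := K) (x := n))
      rcases Finset.mem_insert.mp hc with rfl | hc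
      · have := (hint d).mul hy'
        simpa [mul_assoc] using this
      · have := (hint y).mul (h c hc)
        have e : ((d * y : ℤ) : K) * c = (y : K) * ((d : K) * c) := by
          rw [Int.cast_mul]; ring
        rw [e]
        exact this
  obtain ⟨d, hd, h⟩ := h1
  obtain ⟨p, hpd, hp⟩ := Nat.exists_infinite_primes (d.natAbs + 1)
  let A : Subring K := (integralClosure ℤ K).toSubring
  have hI : (Ideal.span {(p : A)}) ≠ ⊤ := by
    intro htop
    rw [Ideal.span_singleton_eq_top] at htop
    obtain ⟨⟨y, hy⟩, hpy⟩ := isUnit_iff_exists_inv.mp htop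
    have hpy' : (p : K) * y = 1 := by simpa using congrArg (Subtype.val) hpy
    have hp0 : (p : K) ≠ 0 := by exact_mod_cast hp.ne_zero
    have hyq : y = algebraMap ℚ K ((p : ℚ)⁻¹) := by
      rw [map_inv₀]
      simp
      field_simp
      linear_combination hpy'
    have hy2 : IsIntegral ℤ y := hy
    rw [hyq, isIntegral_algebraMap_iff (algebraMap ℚ K).injective] at hy2
    obtain ⟨n, hn⟩ := IsIntegrallyClosed.isIntegral_iff.mp hy2
    have hp0' : (p : ℚ) ≠ 0 := by exact_mod_cast hp.ne_zero
    have : (n : ℚ) * p = 1 := by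
      have : (n : ℚ) = (p : ℚ)⁻¹ := by simpa using hn
      rw [this]; field_simp
    have h3 : n * (p : ℤ) = 1 := by exact_mod_cast this
    have h4 : (p : ℤ) ∣ 1 := ⟨n, by linarith⟩
    have h5 := Int.natCast_dvd_natCast.mp (by simpa using h4 : ((p : ℕ) : ℤ) ∣ ((1 : ℕ) : ℤ))
    exact hp.one_lt.ne' (Nat.dvd_one.mp h5)
  obtain ⟨V, hAV, hV⟩ := Ideal.image_subset_nonunits_valuationSubring _ hI
  have hpV : (p : K) ∈ V.nonunits := by
    apply hV
    exact ⟨(p : A), Ideal.mem_span_singleton_self _, by simp⟩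
  have hpu : ¬ IsUnit (p : V) := by
    have := (ValuationSubring.coe_mem_nonunits_iff (A := V) (a := (p : V))).mp (by simpa using hpV)
    exact this
  refine ⟨V, p, hp, ?_, hpu⟩
  intro c hc
  have hdu : IsUnit (d : V) := by
    have hcop : IsCoprime (p : ℤ) d := by
      rw [Int.isCoprime_iff_gcd_eq_one]
      have : Nat.Coprime p d.natAbs := by
        rw [Nat.Prime.coprime_iff_not_dvd hp]
        intro hdvd
        have := Nat.le_of_dvd (Int.natAbs_pos.mpr hd) hdvd
        omega
      simpa [Int.gcd] using this
    obtain ⟨x, y, hxy⟩ := hcop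
    by_contra hcon
    have m1 : (p : V) ∈ IsLocalRing.maximalIdeal V := hpu
    have m2 : (d : V) ∈ IsLocalRing.maximalIdeal V := hcon
    have m3 : (x : V) * (p : V) + (y : V) * (d : V) ∈ IsLocalRing.maximalIdeal V :=
      Ideal.add_mem _ (Ideal.mul_mem_left _ _ m1) (Ideal.mul_mem_left _ _ m2)
    have m4 : (x : V) * (p : V) + (y : V) * (d : V) = 1 := by exact_mod_cast congrArg (Int.cast (R := V)) hxy
    rw [m4] at m3
    exact m3 isUnit_one
  obtain ⟨e, he⟩ := isUnit_iff_exists_inv.mp hdu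
  have he' : (d : K) * (e : K) = 1 := by simpa using congrArg Subtype.val he
  have hdc : (d : K) * c ∈ V := hAV (h c hc)
  have : c = (e : K) * ((d : K) * c) := by linear_combination (-c) * he'
  rw [this]
  exact V.mul_mem _ _ e.2 hdc

theorem jm_int_dvd {R : Type*} [CommRing R] [IsDomain R] [CharZero R] (p : ℕ) (hp : p.Prime)
    (hpu : ¬ IsUnit (p : R)) (k : ℕ) (n : ℤ) (h : (p : R) ^ k ∣ (n : R)) : (p : ℤ) ^ k ∣ n := by
  induction k generalizing n with
  | zero => simp
  | succ k ih =>
    have h1 : (p : ℤ) ∣ n := by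
      by_contra hcon
      have hcop : IsCoprime (p : ℤ) n :=
        (Prime.coprime_iff_not_dvd (Nat.prime_iff_prime_int.mp hp)).mpr hcon
      obtain ⟨x, y, hxy⟩ := hcop
      have m4 : (x : R) * (p : R) + (y : R) * (n : R) = 1 := by
        exact_mod_cast congrArg (Int.cast (R := R)) hxy
      apply hpu
      apply isUnit_of_dvd_one
      rw [← m4]
      exact dvd_add (dvd_mul_left _ _)
        (((dvd_pow_self _ (Nat.succ_ne_zero k)).trans h).mul_left _)
    obtain ⟨m, rfl⟩ := h1
    rw [pow_succ', ]
    apply mul_dvd_mul_left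
    apply ih
    have hp0 : (p : R) ≠ 0 := by exact_mod_cast hp.ne_zero
    rw [pow_succ'] at h
    push_cast at h
    exact (mul_dvd_mul_iff_left hp0).mp h

theorem jm_hensel {R : Type*} [CommRing R] [IsDomain R] [IsLocalRing R] [CharZero R]
    (F G : MvPolynomial (Fin 2) R)
    (hJ : pderiv 0 F * pderiv 1 G - pderiv 1 F * pderiv 0 G = 1)
    (p : ℕ) (hp : p.Prime) (hpu : ¬ IsUnit (p : R)) (k : ℕ)
    (a₁ a₂ b₁ b₂ : ℤ)
    (hF : eval ![(a₁ : R), (a₂ : R)] F = eval ![(b₁ : R), (b₂ : R)] F)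
    (hG : eval ![(a₁ : R), (a₂ : R)] G = eval ![(b₁ : R), (b₂ : R)] G) :
    ∃ A B C D : R, ∀ u₁ u₂ c₁ c₂ : ℤ,
      eval ![((a₁ + (p : ℤ) ^ k * u₁ : ℤ) : R), ((a₂ + (p : ℤ) ^ k * u₂ : ℤ) : R)] F
        = eval ![(c₁ : R), (c₂ : R)] F →
      eval ![((a₁ + (p : ℤ) ^ k * u₁ : ℤ) : R), ((a₂ + (p : ℤ) ^ k * u₂ : ℤ) : R)] G
        = eval ![(c₁ : R), (c₂ : R)] G →
      (p : ℤ) ∣ c₁ - b₁ → (p : ℤ) ∣ c₂ - b₂ →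
      ∃ v₁ v₂ : ℤ, c₁ = b₁ + (p : ℤ) ^ k * v₁ ∧ c₂ = b₂ + (p : ℤ) ^ k * v₂ ∧
        (p : R) ^ k ∣ v₁ - (A * u₁ + B * u₂) ∧ (p : R) ^ k ∣ v₂ - (C * u₁ + D * u₂) := by
  obtain ⟨F0, F1, hF'⟩ := jm_taylor F
  obtain ⟨G0, G1, hG'⟩ := jm_taylor G
  have hJe : ∀ x y : R, eval ![x, y] (pderiv 0 F) * eval ![x, y] (pderiv 1 G)
      - eval ![x, y] (pderiv 1 F) * eval ![x, y] (pderiv 0 G) = 1 := by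
    intro x y
    simpa using congrArg (eval ![x, y]) hJ
  set af0 := eval ![(a₁ : R), (a₂ : R)] (pderiv 0 F) with haf0
  set af1 := eval ![(a₁ : R), (a₂ : R)] (pderiv 1 F) with haf1
  set ag0 := eval ![(a₁ : R), (a₂ : R)] (pderiv 0 G) with hag0
  set ag1 := eval ![(a₁ : R), (a₂ : R)] (pderiv 1 G) with hag1
  have hb := hJe b₁ b₂
  set bf0 := eval ![(b₁ : R), (b₂ : R)] (pderiv 0 F) with hbf0
  set bf1 := eval ![(b₁ : R), (b₂ : R)] (pderiv 1 F) with hbf1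
  set bg0 := eval ![(b₁ : R), (b₂ : R)] (pderiv 0 G) with hbg0
  set bg1 := eval ![(b₁ : R), (b₂ : R)] (pderiv 1 G) with hbg1
  refine ⟨bg1 * af0 - bf1 * ag0, bg1 * af1 - bf1 * ag1, -bg0 * af0 + bf0 * ag0,
    -bg0 * af1 + bf0 * ag1, ?_⟩
  intro u₁ u₂ c₁ c₂ hFc hGc hc₁ hc₂
  obtain ⟨eFa, dFa⟩ := hF' a₁ a₂ ((a₁ + (p : ℤ) ^ k * u₁ : ℤ) : R) ((a₂ + (p : ℤ) ^ k * u₂ : ℤ) : R)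
  obtain ⟨eGa, dGa⟩ := hG' a₁ a₂ ((a₁ + (p : ℤ) ^ k * u₁ : ℤ) : R) ((a₂ + (p : ℤ) ^ k * u₂ : ℤ) : R)
  obtain ⟨eFb, dFb⟩ := hF' b₁ b₂ c₁ c₂
  obtain ⟨eGb, dGb⟩ := hG' b₁ b₂ c₁ c₂
  rw [hFc, hF] at eFa
  rw [hGc, hG] at eGa
  rw [eFa] at eFb
  rw [eGa] at eGb
  obtain ⟨dFa0, dFa1⟩ := dFa ((p : R) ^ k) ⟨u₁, by push_cast; ring⟩ ⟨u₂, by push_cast; ring⟩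
  obtain ⟨dGa0, dGa1⟩ := dGa ((p : R) ^ k) ⟨u₁, by push_cast; ring⟩ ⟨u₂, by push_cast; ring⟩
  clear dFa dGa hF' hG' eFa eGa
  rw [← haf0] at dFa0
  rw [← haf1] at dFa1
  rw [← hag0] at dGa0
  rw [← hag1] at dGa1
  rw [← hbf0, ← hbf1] at dFb
  rw [← hbg0, ← hbg1] at dGb
  generalize F0 a₁ a₂ _ _ = Fa0 at *
  generalize F1 a₁ a₂ _ _ = Fa1 at *
  generalize G0 a₁ a₂ _ _ = Ga0 at *
  generalize G1 a₁ a₂ _ _ = Ga1 at *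
  generalize F0 b₁ b₂ _ _ = Fb0 at *
  generalize F1 b₁ b₂ _ _ = Fb1 at *
  generalize G0 b₁ b₂ _ _ = Gb0 at *
  generalize G1 b₁ b₂ _ _ = Gb1 at *
  clear_value af0 af1 ag0 ag1 bf0 bf1 bg0 bg1
  push_cast at eFb eGb
  have hpc₁ : (p : R) ∣ (c₁ : R) - b₁ := by
    obtain ⟨t, ht⟩ := hc₁
    exact ⟨t, by exact_mod_cast congrArg (Int.cast (R := R)) ht⟩
  have hpc₂ : (p : R) ∣ (c₂ : R) - b₂ := by
    obtain ⟨t, ht⟩ := hc₂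
    exact ⟨t, by exact_mod_cast congrArg (Int.cast (R := R)) ht⟩
  obtain ⟨⟨x1, h1⟩, ⟨x2, h2⟩⟩ := dFb _ hpc₁ hpc₂
  obtain ⟨⟨x3, h3⟩, ⟨x4, h4⟩⟩ := dGb _ hpc₁ hpc₂
  have hdet : (p : R) ∣ 1 - (Fb0 * Gb1 - Fb1 * Gb0) := by
    refine ⟨-(x1 * Gb1 + bf0 * x4 - x2 * Gb0 - bf1 * x3), ?_⟩
    linear_combination (-1) * hb - h1 * Gb1 - bf0 * h4 + h2 * Gb0 + bf1 * h3
  have hunit : IsUnit (Fb0 * Gb1 - Fb1 * Gb0) := by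
    by_contra hcon
    have m1 : (p : R) ∈ IsLocalRing.maximalIdeal R := hpu
    have m2 : (Fb0 * Gb1 - Fb1 * Gb0) ∈ IsLocalRing.maximalIdeal R := hcon
    have m3 := Ideal.add_mem _ (Ideal.mem_of_dvd _ hdet m1) m2
    rw [sub_add_cancel] at m3
    exact m3 isUnit_one
  have q1 : (p : R) ^ k ∣ ((c₁ - b₁ : ℤ) : R) := by
    rw [← hunit.dvd_mul_left]
    refine ⟨Gb1 * (Fa0 * u₁ + Fa1 * u₂) - Fb1 * (Ga0 * u₁ + Ga1 * u₂), ?_⟩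
    push_cast
    linear_combination (-Gb1) * eFb + Fb1 * eGb
  have q2 : (p : R) ^ k ∣ ((c₂ - b₂ : ℤ) : R) := by
    rw [← hunit.dvd_mul_left]
    refine ⟨-Gb0 * (Fa0 * u₁ + Fa1 * u₂) + Fb0 * (Ga0 * u₁ + Ga1 * u₂), ?_⟩
    push_cast
    linear_combination (Gb0) * eFb - Fb0 * eGb
  obtain ⟨v₁, hv₁⟩ := jm_int_dvd p hp hpu k _ q1
  obtain ⟨v₂, hv₂⟩ := jm_int_dvd p hp hpu k _ q2
  refine ⟨v₁, v₂, by linarith, by linarith, ?_⟩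
  have w₁ : (c₁ : R) - b₁ = (p : R) ^ k * v₁ := by exact_mod_cast congrArg (Int.cast (R := R)) hv₁
  have w₂ : (c₂ : R) - b₂ = (p : R) ^ k * v₂ := by exact_mod_cast congrArg (Int.cast (R := R)) hv₂
  have hq0 : (p : R) ^ k ≠ 0 := pow_ne_zero _ (by exact_mod_cast hp.ne_zero)
  obtain ⟨⟨y1, g1⟩, ⟨y2, g2⟩⟩ := dFb ((p : R) ^ k) ⟨_, w₁⟩ ⟨_, w₂⟩
  obtain ⟨⟨y3, g3⟩, ⟨y4, g4⟩⟩ := dGb ((p : R) ^ k) ⟨_, w₁⟩ ⟨_, w₂⟩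
  rw [w₁, w₂] at eFb eGb
  have eF : Fa0 * u₁ + Fa1 * u₂ = Fb0 * v₁ + Fb1 * v₂ := by
    apply mul_left_cancel₀ hq0
    linear_combination eFb
  have eG : Ga0 * u₁ + Ga1 * u₂ = Gb0 * v₁ + Gb1 * v₂ := by
    apply mul_left_cancel₀ hq0
    linear_combination eGb
  obtain ⟨z1, k1⟩ := dFa0
  obtain ⟨z2, k2⟩ := dFa1
  obtain ⟨z3, k3⟩ := dGa0
  obtain ⟨z4, k4⟩ := dGa1
  have r1 : (p : R) ^ k ∣ bf0 * v₁ + bf1 * v₂ - (af0 * u₁ + af1 * u₂) :=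
    ⟨z1 * u₁ + z2 * u₂ - (y1 * v₁ + y2 * v₂), by
      linear_combination (-(v₁ : R)) * g1 - v₂ * g2 + u₁ * k1 + u₂ * k2 - eF⟩
  have r2 : (p : R) ^ k ∣ bg0 * v₁ + bg1 * v₂ - (ag0 * u₁ + ag1 * u₂) :=
    ⟨z3 * u₁ + z4 * u₂ - (y3 * v₁ + y4 * v₂), by
      linear_combination (-(v₁ : R)) * g3 - v₂ * g4 + u₁ * k3 + u₂ * k4 - eG⟩
  constructor
  · convert dvd_sub (r1.mul_left bg1) (r2.mul_left bf1) using 1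
    linear_combination (-(v₁ : R)) * hb
  · convert dvd_sub (r2.mul_left bf0) (r1.mul_left bg0) using 1
    linear_combination (-(v₂ : R)) * hb

theorem jm_sz {K : Type*} [Field K] [CharZero K] (h : MvPolynomial (Fin 2) K) (D B : ℕ)
    (X : Finset (ℤ × ℤ)) (hX : ∀ u ∈ X, |u.1| ≤ B ∧ |u.2| ≤ B)
    (hdeg : h.totalDegree ≤ D) (hcard : D * (2 * B + 1) < X.card)
    (hz : ∀ u ∈ X, eval ![(u.1 : K), (u.2 : K)] h = 0) : h = 0 := by
  classical
  by_contra hne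
  let S : Finset K := (Finset.Icc (-(B : ℤ)) B).image (fun n : ℤ => (n : K))
  have hS : S.card = 2 * B + 1 := by
    rw [Finset.card_image_of_injective _ Int.cast_injective]
    simp; omega
  have sz := schwartz_zippel_totalDegree hne S
  have hle : X.card ≤ (Finset.filter (fun f => eval f h = 0)
      (Fintype.piFinset fun _ : Fin 2 => S)).card := by
    apply Finset.card_le_card_of_injOn (fun u => ![(u.1 : K), (u.2 : K)])
    · intro u hu
      have hu : u ∈ X := hu
      obtain ⟨h1, h2⟩ := hX u hu
      rw [abs_le] at h1 h2
      simp only [Finset.coe_filter, Fintype.mem_piFinset, Set.mem_ofPred_eq]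
      refine ⟨?_, hz u hu⟩
      intro i
      fin_cases i
      · exact Finset.mem_image.mpr ⟨u.1, by simpa using h1, rfl⟩
      · exact Finset.mem_image.mpr ⟨u.2, by simpa using h2, rfl⟩
    · intro u _ v _ huv
      have h1 := congrFun huv 0
      have h2 := congrFun huv 1
      simp at h1 h2
      exact Prod.ext h1 h2
  rw [hS] at sz
  have hpos : (0 : ℚ≥0) < ((2 * B + 1 : ℕ) : ℚ≥0) := by positivity
  rw [div_le_div_iff₀ (by positivity) hpos] at sz
  have sz2 : (Finset.filter (fun f => eval f h = 0)
      (Fintype.piFinset fun _ : Fin 2 => S)).card * (2 * B + 1)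
      ≤ h.totalDegree * (2 * B + 1) ^ 2 := by exact_mod_cast sz
  nlinarith [Nat.mul_le_mul_right ((2 * B + 1) ^ 2) hdeg, Nat.mul_le_mul_right (2 * B + 1) hle]

theorem jm_deg {K : Type*} [Field K] (f : MvPolynomial (Fin 2) K)
    (l : Fin 2 → MvPolynomial (Fin 2) K) (hl : ∀ i, (l i).totalDegree ≤ 1) :
    (aeval l f).totalDegree ≤ f.totalDegree := by
  rw [aeval_def, eval₂_eq]
  apply totalDegree_finsetSum_le
  intro d hd
  refine (totalDegree_mul _ _).trans ?_
  have h1 : (algebraMap K (MvPolynomial (Fin 2) K) (coeff d f)).totalDegree = 0 := totalDegree_C _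
  rw [h1, zero_add]
  refine (totalDegree_finsetProd _ _).trans ?_
  refine le_trans ?_ (le_totalDegree hd)
  apply Finset.sum_le_sum
  intro i _
  refine (totalDegree_pow _ _).trans ?_
  simpa using Nat.mul_le_mul_left (d i) (hl i)

theorem jm_lin_deg {K : Type*} [Field K] (a b c : K) :
    (C a + C b * X 0 + C c * X 1 : MvPolynomial (Fin 2) K).totalDegree ≤ 1 := by
  refine (totalDegree_add _ _).trans (max_le ((totalDegree_add _ _).trans (max_le ?_ ?_)) ?_)
  · simp
  · exact (totalDegree_mul _ _).trans (by simp)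
  · exact (totalDegree_mul _ _).trans (by simp)

theorem jm_eval_map {R K : Type*} [CommRing R] [CommRing K] (φ : R →+* K)
    (F : MvPolynomial (Fin 2) R) (x y : R) :
    φ (eval ![x, y] F) = eval ![φ x, φ y] (map φ F) := by
  induction F using MvPolynomial.induction_on with
  | C a => simp
  | add p q hp hq => simp only [map_add, hp, hq]
  | mul_X p i hp =>
    fin_cases i <;> simp [hp]

theorem jm_abs2 (M x y z w : ℤ) (hx : |x| ≤ M) (hy : |y| ≤ M) (hz : |z| ≤ M) (hw : |w| ≤ M) :
    |x * y - z * w| ≤ 2 * M ^ 2 := by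
  have h1 : |x * y| ≤ M * M := by
    rw [abs_mul]; exact mul_le_mul hx hy (abs_nonneg _) ((abs_nonneg _).trans hx)
  have h2 : |z * w| ≤ M * M := by
    rw [abs_mul]; exact mul_le_mul hz hw (abs_nonneg _) ((abs_nonneg _).trans hx)
  have := abs_sub (x * y) (z * w)
  nlinarith

theorem jm_abs3 (M d a b v v₁ v₂ : ℤ) (hd : |d| ≤ 2 * M ^ 2) (ha : |a| ≤ 2 * M ^ 2)
    (hb : |b| ≤ 2 * M ^ 2) (hv : |v| ≤ M) (hv₁ : |v₁| ≤ M) (hv₂ : |v₂| ≤ M) :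
    |d * v - a * v₁ - b * v₂| ≤ 6 * M ^ 3 := by
  have aux : ∀ s t : ℤ, |s| ≤ 2 * M ^ 2 → |t| ≤ M → |s * t| ≤ 2 * M ^ 2 * M := by
    intro s t hs ht
    rw [abs_mul]; exact mul_le_mul hs ht (abs_nonneg _) ((abs_nonneg _).trans hs)
  have h1 := aux d v hd hv
  have h2 := aux a v₁ ha hv₁
  have h3 := aux b v₂ hb hv₂
  have h4 := abs_sub (d * v - a * v₁) (b * v₂)
  have h5 := abs_sub (d * v) (a * v₁)
  nlinarith

set_option maxHeartbeats 2000000 in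
theorem jm_class {K : Type*} [Field K] [CharZero K] (f g : MvPolynomial (Fin 2) K)
    (hJ : pderiv 0 f * pderiv 1 g - pderiv 1 f * pderiv 0 g = 1)
    (V : ValuationSubring K) (F G : MvPolynomial (Fin 2) V)
    (hF : map V.subtype F = f) (hG : map V.subtype G = g)
    (p : ℕ) (hp : p.Prime) (hpu : ¬ IsUnit (p : V)) (k L D : ℕ)
    (hDf : f.totalDegree ≤ D) (hDg : g.totalDegree ≤ D) (hD1 : 1 ≤ D)
    (hq : 48 * L ^ 3 < p ^ k)
    (Xs : Finset (ℤ × ℤ)) (β : ℤ × ℤ → ℤ × ℤ) (a₀ : ℤ × ℤ) (ha₀ : a₀ ∈ Xs)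
    (hβ : ∀ a ∈ Xs, β a ≠ a ∧
      eval ![(a.1 : K), (a.2 : K)] f = eval ![((β a).1 : K), ((β a).2 : K)] f ∧
      eval ![(a.1 : K), (a.2 : K)] g = eval ![((β a).1 : K), ((β a).2 : K)] g)
    (hmod : ∀ a ∈ Xs, (p : ℤ) ^ k ∣ a.1 - a₀.1 ∧ (p : ℤ) ^ k ∣ a.2 - a₀.2 ∧
      (p : ℤ) ∣ (β a).1 - (β a₀).1 ∧ (p : ℤ) ∣ (β a).2 - (β a₀).2)
    (hbd : ∀ a ∈ Xs, |a.1| < (p : ℤ) ^ k * L ∧ |a.2| < (p : ℤ) ^ k * L ∧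
      |(β a).1| < (p : ℤ) ^ k * L ∧ |(β a).2| < (p : ℤ) ^ k * L)
    (hcard : D * (2 * (2 * L) + 1) < Xs.card) : False := by
  classical
  have hinj : Function.Injective V.subtype := Subtype.val_injective
  have : CharZero V := ⟨fun m n h => by
    have := congrArg V.subtype h
    simpa using this⟩
  have hJV : pderiv 0 F * pderiv 1 G - pderiv 1 F * pderiv 0 G = 1 := by
    apply map_injective _ hinj
    rw [map_sub, map_mul, map_mul, ← pderiv_map, ← pderiv_map, ← pderiv_map, ← pderiv_map, hF, hG,
      hJ, map_one]
  have evF : ∀ m n : ℤ, V.subtype (eval ![(m : V), (n : V)] F) = eval ![(m : K), (n : K)] f := by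
    intro m n
    rw [jm_eval_map, hF]; simp
  have evG : ∀ m n : ℤ, V.subtype (eval ![(m : V), (n : V)] G) = eval ![(m : K), (n : K)] g := by
    intro m n
    rw [jm_eval_map, hG]; simp
  set q : ℤ := (p : ℤ) ^ k with hqdef
  have hq48 : 48 * (L : ℤ) ^ 3 < q := by rw [hqdef]; exact_mod_cast hq
  have hq0 : 0 < q := by rw [hqdef]; exact_mod_cast pow_pos hp.pos k
  obtain ⟨hne0, hf0, hg0⟩ := hβ a₀ ha₀
  set b₀ := β a₀ with hb₀
  obtain ⟨A, B, C', D', hens⟩ := jm_hensel F G hJV p hp hpu k a₀.1 a₀.2 b₀.1 b₀.2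
    (hinj (by rw [evF, evF]; exact hf0)) (hinj (by rw [evG, evG]; exact hg0))
  rw [← hqdef] at hens
  have qb : ∀ s t u : ℤ, |s| < q * L → |t| < q * L → s - t = q * u → |u| ≤ ((2 * L : ℕ) : ℤ) := by
    intro s t u hs ht hu
    have h1 := abs_sub s t
    rw [hu, abs_mul, abs_of_pos hq0] at h1
    push_cast
    have : q * |u| < q * (2 * L) := by nlinarith
    exact (lt_of_mul_lt_mul_left this hq0.le).le
  let U : ℤ × ℤ → ℤ × ℤ := fun a => ((a.1 - a₀.1) / q, (a.2 - a₀.2) / q)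
  have hU : ∀ a ∈ Xs, a.1 = a₀.1 + q * (U a).1 ∧ a.2 = a₀.2 + q * (U a).2 := by
    intro a ha
    obtain ⟨h1, h2, -, -⟩ := hmod a ha
    have e1 := Int.mul_ediv_cancel' h1
    have e2 := Int.mul_ediv_cancel' h2
    constructor
    · show a.1 = a₀.1 + q * ((a.1 - a₀.1) / q)
      linarith
    · show a.2 = a₀.2 + q * ((a.2 - a₀.2) / q)
      linarith
  let Y := Xs.image U
  have hYcard : Y.card = Xs.card := by
    apply Finset.card_image_of_injOn
    intro a ha a' ha' h
    obtain ⟨h1, h2⟩ := hU a ha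
    obtain ⟨h3, h4⟩ := hU a' ha'
    rw [h] at h1 h2
    exact Prod.ext (h1.trans h3.symm) (h2.trans h4.symm)
  have data : ∀ u ∈ Y, (|u.1| ≤ ((2 * L : ℕ) : ℤ) ∧ |u.2| ≤ ((2 * L : ℕ) : ℤ)) ∧
      ∃ v₁ v₂ : ℤ, |v₁| ≤ ((2 * L : ℕ) : ℤ) ∧ |v₂| ≤ ((2 * L : ℕ) : ℤ) ∧
        (p : V) ^ k ∣ v₁ - (A * u.1 + B * u.2) ∧ (p : V) ^ k ∣ v₂ - (C' * u.1 + D' * u.2) ∧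
        eval ![((a₀.1 + q * u.1 : ℤ) : K), ((a₀.2 + q * u.2 : ℤ) : K)] f =
          eval ![((b₀.1 + q * v₁ : ℤ) : K), ((b₀.2 + q * v₂ : ℤ) : K)] f ∧
        eval ![((a₀.1 + q * u.1 : ℤ) : K), ((a₀.2 + q * u.2 : ℤ) : K)] g =
          eval ![((b₀.1 + q * v₁ : ℤ) : K), ((b₀.2 + q * v₂ : ℤ) : K)] g := by
    intro u hu
    obtain ⟨a, ha, rfl⟩ := Finset.mem_image.mp hu
    obtain ⟨h1, h2⟩ := hU a ha
    obtain ⟨-, hfa, hga⟩ := hβ a ha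
    obtain ⟨m1, m2, m3, m4⟩ := hmod a ha
    obtain ⟨n1, n2, n3, n4⟩ := hbd a ha
    obtain ⟨o1, o2, o3, o4⟩ := hbd a₀ ha₀
    refine ⟨⟨qb a.1 a₀.1 _ n1 o1 (by linarith), qb a.2 a₀.2 _ n2 o2 (by linarith)⟩, ?_⟩
    obtain ⟨v₁, v₂, e1, e2, d1, d2⟩ := hens (U a).1 (U a).2 (β a).1 (β a).2
      (hinj (by rw [evF, evF, ← h1, ← h2]; exact hfa))
      (hinj (by rw [evG, evG, ← h1, ← h2]; exact hga)) m3 m4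
    refine ⟨v₁, v₂, qb _ _ _ n3 o3 (by linarith), qb _ _ _ n4 o4 (by linarith), d1, d2, ?_, ?_⟩
    · rw [← h1, ← h2, ← e1, ← e2]; exact hfa
    · rw [← h1, ← h2, ← e1, ← e2]; exact hga
  have hYc : D * (2 * (2 * L) + 1) < Y.card := by rw [hYcard]; exact hcard
  have hindep : ∃ r ∈ Y, ∃ s ∈ Y, r.1 * s.2 - r.2 * s.1 ≠ 0 := by
    by_contra! hcon
    have hone : 1 < Y.card := lt_of_le_of_lt (by nlinarith) hYc
    obtain ⟨r, hr, hr0⟩ := Finset.exists_mem_ne hone (0, 0)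
    have hz := jm_sz (K := K) (C (0 : K) + C (-(r.2 : K)) * X 0 + C (r.1 : K) * X 1) D (2 * L) Y
      (fun u hu => (data u hu).1) ((jm_lin_deg _ _ _).trans hD1) hYc (by
        intro s hs
        have := hcon r hr s hs
        have h' : (r.1 : K) * s.2 - r.2 * s.1 = 0 := by exact_mod_cast this
        simp
        linear_combination h')
    have h1 := congrArg (eval ![-(r.2 : K), (r.1 : K)]) hz
    simp at h1
    have h2 : r.2 * r.2 + r.1 * r.1 = 0 := by exact_mod_cast h1
    apply hr0
    have h3 : r.1 = 0 := by nlinarith [mul_self_nonneg r.1, mul_self_nonneg r.2]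
    have h4 : r.2 = 0 := by nlinarith [mul_self_nonneg r.1, mul_self_nonneg r.2]
    exact Prod.ext h3 h4
  obtain ⟨r, hr, s, hs, hδ⟩ := hindep
  obtain ⟨⟨br1, br2⟩, x₁, x₂, bx1, bx2, dx1, dx2, -, -⟩ := data r hr
  obtain ⟨⟨bs1, bs2⟩, y₁, y₂, by1, by2, dy1, dy2, -, -⟩ := data s hs
  set δ := r.1 * s.2 - r.2 * s.1 with hδdef
  have exactlin : ∀ (P Q : V) (u : ℤ × ℤ) (v x y : ℤ),
      |u.1| ≤ ((2 * L : ℕ) : ℤ) → |u.2| ≤ ((2 * L : ℕ) : ℤ) →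
      |v| ≤ ((2 * L : ℕ) : ℤ) → |x| ≤ ((2 * L : ℕ) : ℤ) → |y| ≤ ((2 * L : ℕ) : ℤ) →
      (p : V) ^ k ∣ v - (P * u.1 + Q * u.2) → (p : V) ^ k ∣ x - (P * r.1 + Q * r.2) →
      (p : V) ^ k ∣ y - (P * s.1 + Q * s.2) →
      δ * v = (u.1 * s.2 - u.2 * s.1) * x + (r.1 * u.2 - r.2 * u.1) * y := by
    intro P Q u v x y hu1 hu2 hv hx hy dv dx dy
    have hb := jm_abs3 ((2 * L : ℕ) : ℤ) δ (u.1 * s.2 - u.2 * s.1) (r.1 * u.2 - r.2 * u.1) v x y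
      (jm_abs2 _ _ _ _ _ br1 bs2 br2 bs1) (jm_abs2 _ _ _ _ _ hu1 bs2 hu2 bs1)
      (jm_abs2 _ _ _ _ _ br1 hu2 br2 hu1) hv hx hy
    have hdvd : (p : V) ^ k ∣ ((δ * v - (u.1 * s.2 - u.2 * s.1) * x - (r.1 * u.2 - r.2 * u.1) * y : ℤ) : V) := by
      convert dvd_sub (dvd_sub (dv.mul_left (δ : V))
        (dx.mul_left ((u.1 * s.2 - u.2 * s.1 : ℤ) : V)))
        (dy.mul_left ((r.1 * u.2 - r.2 * u.1 : ℤ) : V)) using 1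
      rw [hδdef]
      push_cast
      ring
    have hdvd2 := jm_int_dvd p hp hpu k _ hdvd
    have h0 := Int.eq_zero_of_abs_lt_dvd hdvd2 (by
      refine lt_of_le_of_lt hb ?_
      rw [← hqdef]
      push_cast
      nlinarith)
    linarith
  have hδK : (δ : K) ≠ 0 := by exact_mod_cast hδ
  have hqK : (q : K) ≠ 0 := by exact_mod_cast hq0.ne'
  set a : K := (s.2 * x₁ - r.2 * y₁) / δ with ha
  set b : K := (-s.1 * x₁ + r.1 * y₁) / δ with hb
  set c : K := (s.2 * x₂ - r.2 * y₂) / δ with hc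
  set d : K := (-s.1 * x₂ + r.1 * y₂) / δ with hd
  have lin : ∀ h : MvPolynomial (Fin 2) K, h.totalDegree ≤ D →
      (∀ u ∈ Y, ∃ v₁ v₂ : ℤ, (v₁ : K) = a * u.1 + b * u.2 ∧ (v₂ : K) = c * u.1 + d * u.2 ∧
        eval ![((a₀.1 + q * u.1 : ℤ) : K), ((a₀.2 + q * u.2 : ℤ) : K)] h =
          eval ![((b₀.1 + q * v₁ : ℤ) : K), ((b₀.2 + q * v₂ : ℤ) : K)] h) →
      ∀ x y : K, eval ![a * x + b * y + (b₀.1 - a * a₀.1 - b * a₀.2),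
        c * x + d * y + (b₀.2 - c * a₀.1 - d * a₀.2)] h = eval ![x, y] h := by
    intro h hh hall x y
    have evl : ∀ (l₀ l₁ : MvPolynomial (Fin 2) K) (u w : K),
        eval ![u, w] (aeval ![l₀, l₁] h) = eval ![eval ![u, w] l₀, eval ![u, w] l₁] h := by
      intro l₀ l₁ u w
      clear hh hall
      induction h using MvPolynomial.induction_on with
      | C a => simp
      | add p q hp hq => simp only [map_add, hp, hq]
      | mul_X p i hp =>
        rw [map_mul, map_mul, map_mul, hp]
        fin_cases i <;> simp
    have hz := jm_sz (aeval ![C (b₀.1 : K) + C (q * a) * X 0 + C (q * b) * X 1,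
        C (b₀.2 : K) + C (q * c) * X 0 + C (q * d) * X 1] h -
        aeval ![C (a₀.1 : K) + C (q : K) * X 0 + C (0 : K) * X 1,
        C (a₀.2 : K) + C (0 : K) * X 0 + C (q : K) * X 1] h) D (2 * L) Y
      (fun u hu => (data u hu).1) (by
        refine (totalDegree_sub _ _).trans (max_le ?_ ?_)
        · refine (jm_deg h _ ?_).trans hh
          intro i
          fin_cases i
          · exact jm_lin_deg _ _ _
          · exact jm_lin_deg _ _ _
        · refine (jm_deg h _ ?_).trans hh
          intro i
          fin_cases i
          · exact jm_lin_deg _ _ _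
          · exact jm_lin_deg _ _ _) hYc (by
        intro u hu
        obtain ⟨v₁, v₂, e1, e2, e3⟩ := hall u hu
        rw [map_sub, evl, evl, sub_eq_zero]
        push_cast at e3
        rw [e1, e2] at e3
        simp only [map_add, map_mul, eval_C, eval_X, Matrix.cons_val_zero, Matrix.cons_val_one]
        have n1 : (b₀.1 : K) + q * a * u.1 + q * b * u.2 = b₀.1 + q * (a * u.1 + b * u.2) := by ring
        have n2 : (b₀.2 : K) + q * c * u.1 + q * d * u.2 = b₀.2 + q * (c * u.1 + d * u.2) := by ring
        have n3 : (a₀.1 : K) + q * u.1 + 0 * u.2 = a₀.1 + q * u.1 := by ring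
        have n4 : (a₀.2 : K) + 0 * u.1 + q * u.2 = a₀.2 + q * u.2 := by ring
        rw [n1, n2, n3, n4]
        exact e3.symm)
    have h1 := congrArg (eval ![(x - a₀.1) / q, (y - a₀.2) / q]) hz
    rw [map_sub, evl, evl, (eval ![(x - a₀.1) / q, (y - a₀.2) / q]).map_zero,
      sub_eq_zero] at h1
    simp only [map_add, map_mul, eval_C, eval_X, Matrix.cons_val_zero, Matrix.cons_val_one] at h1
    have t1 : (a₀.1 : K) + q * ((x - a₀.1) / q) + 0 * ((y - a₀.2) / q) = x := by
      field_simp; ring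
    have t2 : (a₀.2 : K) + 0 * ((x - a₀.1) / q) + q * ((y - a₀.2) / q) = y := by
      field_simp; ring
    have t3 : ∀ e m n : K, e + q * m * ((x - a₀.1) / q) + q * n * ((y - a₀.2) / q)
        = m * x + n * y + (e - m * a₀.1 - n * a₀.2) := by
      intro e m n
      field_simp; ring
    rw [t1, t2, t3, t3] at h1
    exact h1
  have allu : ∀ u ∈ Y, ∃ v₁ v₂ : ℤ, ((v₁ : K) = a * u.1 + b * u.2 ∧ (v₂ : K) = c * u.1 + d * u.2) ∧
        eval ![((a₀.1 + q * u.1 : ℤ) : K), ((a₀.2 + q * u.2 : ℤ) : K)] f =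
          eval ![((b₀.1 + q * v₁ : ℤ) : K), ((b₀.2 + q * v₂ : ℤ) : K)] f ∧
        eval ![((a₀.1 + q * u.1 : ℤ) : K), ((a₀.2 + q * u.2 : ℤ) : K)] g =
          eval ![((b₀.1 + q * v₁ : ℤ) : K), ((b₀.2 + q * v₂ : ℤ) : K)] g := by
    intro u hu
    obtain ⟨⟨bu1, bu2⟩, v₁, v₂, bv1, bv2, dv1, dv2, e1, e2⟩ := data u hu
    refine ⟨v₁, v₂, ⟨?_, ?_⟩, e1, e2⟩
    · have := exactlin A B u v₁ x₁ y₁ bu1 bu2 bv1 bx1 by1 dv1 dx1 dy1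
      have h' : (δ : K) * v₁ = (u.1 * s.2 - u.2 * s.1) * x₁ + (r.1 * u.2 - r.2 * u.1) * y₁ := by
        exact_mod_cast this
      rw [ha, hb]
      field_simp
      linear_combination h'
    · have := exactlin C' D' u v₂ x₂ y₂ bu1 bu2 bv2 bx2 by2 dv2 dx2 dy2
      have h' : (δ : K) * v₂ = (u.1 * s.2 - u.2 * s.1) * x₂ + (r.1 * u.2 - r.2 * u.1) * y₂ := by
        exact_mod_cast this
      rw [hc, hd]
      field_simp
      linear_combination h'
  have hfin := jm_affine f g hJ a b c d (b₀.1 - a * a₀.1 - b * a₀.2) (b₀.2 - c * a₀.1 - d * a₀.2)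
    (lin f hDf (fun u hu => by
      obtain ⟨v₁, v₂, ⟨h1, h2⟩, h3, -⟩ := allu u hu
      exact ⟨v₁, v₂, h1, h2, h3⟩))
    (lin g hDg (fun u hu => by
      obtain ⟨v₁, v₂, ⟨h1, h2⟩, -, h3⟩ := allu u hu
      exact ⟨v₁, v₂, h1, h2, h3⟩)) a₀.1 a₀.2
  obtain ⟨h1, h2⟩ := hfin
  have h3 : (b₀.1 : K) = a₀.1 := by linear_combination h1
  have h4 : (b₀.2 : K) = a₀.2 := by linear_combination h2
  exact hne0 (Prod.ext (by exact_mod_cast h3) (by exact_mod_cast h4))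

/-- Theorem 2: if `P = (f, g) : K² → K²` has Jacobian determinant identically `1` over an
algebraic number field `K`, then `P` is injective for almost all rational integers: there is
a set `S ⊆ ℤ²` whose complement in `[-N, N]²` has `o(N²)` integer points, on which `P` is
injective. -/
theorem jacobian_map_injective_on_almost_all_integers
    {K : Type*} [Field K] [NumberField K]
    (f g : MvPolynomial (Fin 2) K)
    (hJ : pderiv 0 f * pderiv 1 g - pderiv 1 f * pderiv 0 g = 1) :
    ∃ S : Set (ℤ × ℤ),
      (∀ ε : ℝ, 0 < ε → ∃ N₀ : ℕ, ∀ N : ℕ, N₀ ≤ N →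
        ({p : ℤ × ℤ | |p.1| ≤ (N : ℤ) ∧ |p.2| ≤ (N : ℤ) ∧ p ∉ S}.ncard : ℝ)
          ≤ ε * (N : ℝ) ^ 2) ∧
      ∀ p ∈ S, ∀ q ∈ S,
        (eval ![(p.1 : K), (p.2 : K)] f = eval ![(q.1 : K), (q.2 : K)] f ∧
         eval ![(p.1 : K), (p.2 : K)] g = eval ![(q.1 : K), (q.2 : K)] g) → p = q := by
  classical
  let Bad : ℤ × ℤ → ℤ × ℤ → Prop := fun a b => b ≠ a ∧
    (eval ![(a.1 : K), (a.2 : K)] f = eval ![(b.1 : K), (b.2 : K)] f ∧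
      eval ![(a.1 : K), (a.2 : K)] g = eval ![(b.1 : K), (b.2 : K)] g) ∧
    max |b.1| |b.2| ≤ max |a.1| |a.2|
  refine ⟨{a | ¬ ∃ b, Bad a b}, ?_, ?_⟩
  swap
  · intro a ha b hb hab
    by_contra hne
    rcases le_total (max |b.1| |b.2|) (max |a.1| |a.2|) with h | h
    · exact ha ⟨b, fun e => hne e.symm, hab, h⟩
    · exact hb ⟨a, hne, ⟨hab.1.symm, hab.2.symm⟩, h⟩
  obtain ⟨V, p, hp, hV, hpu⟩ := jm_valuation
    (f.support.image (fun m => coeff m f) ∪ g.support.image (fun m => coeff m g))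
  have lift : ∀ h : MvPolynomial (Fin 2) K, (∀ m ∈ h.support, coeff m h ∈ V) →
      ∃ H : MvPolynomial (Fin 2) V, map V.subtype H = h := by
    intro h hh
    have : h ∈ (map V.subtype : MvPolynomial (Fin 2) V →+* MvPolynomial (Fin 2) K).range := by
      rw [h.as_sum]
      apply Subring.sum_mem
      intro m hm
      exact ⟨monomial m ⟨coeff m h, hh m hm⟩, by simp [map_monomial]⟩
    exact this
  obtain ⟨F, hF⟩ := lift f (fun m hm => hV _ (Finset.mem_union_left _
    (Finset.mem_image_of_mem (fun m => coeff m f) hm)))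
  obtain ⟨G, hG⟩ := lift g (fun m hm => hV _ (Finset.mem_union_right _
    (Finset.mem_image_of_mem (fun m => coeff m g) hm)))
  set D := max 1 (max f.totalDegree g.totalDegree) with hD
  intro ε hε
  obtain ⟨H₀, hH₀⟩ := exists_nat_gt ((5 * p ^ 3 * D : ℕ) / ε : ℝ)
  set H := H₀ + 1 with hH
  have hHε : ((5 * p ^ 3 * D : ℕ) : ℝ) ≤ ε * H := by
    rw [div_lt_iff₀ hε] at hH₀
    rw [hH]; push_cast at hH₀ ⊢; nlinarith
  set L := p * H with hL
  have hHpos : 0 < H := Nat.succ_pos _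
  have hppos := hp.pos
  have hLpos : 0 < L := Nat.mul_pos hppos hHpos
  refine ⟨48 * L ^ 4 + H, ?_⟩
  intro N hN
  by_contra hlt
  rw [not_le] at hlt
  set k := Nat.log p (N / H) with hk
  have hNH : N / H ≠ 0 := by
    have : H ≤ N := by omega
    exact (Nat.div_pos this hHpos).ne'
  have hq1 : p ^ k ≤ N / H := Nat.pow_log_le_self p hNH
  have hq2 : N / H < p ^ (k + 1) := Nat.lt_pow_succ_log_self hp.one_lt _
  have hq1' : p ^ k * H ≤ N := (Nat.le_div_iff_mul_le hHpos).mp hq1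
  have hq2' : N < p ^ k * L := by
    have := (Nat.div_lt_iff_lt_mul hHpos).mp hq2
    rw [hL]
    calc N < p ^ (k + 1) * H := this
      _ = p ^ k * (p * H) := by ring
  have hq48 : 48 * L ^ 3 < p ^ k := by
    have h1 : 48 * L ^ 3 * L < p ^ k * L := by
      calc 48 * L ^ 3 * L = 48 * L ^ 4 := by ring
        _ ≤ N := by omega
        _ < _ := hq2'
    exact lt_of_mul_lt_mul_right h1 (Nat.zero_le _)
  let box : Finset (ℤ × ℤ) := Finset.Icc (-(N : ℤ)) N ×ˢ Finset.Icc (-(N : ℤ)) N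
  let W : Finset (ℤ × ℤ) := box.filter (fun a => ∃ b, Bad a b)
  have hW : {a : ℤ × ℤ | |a.1| ≤ (N : ℤ) ∧ |a.2| ≤ (N : ℤ) ∧ a ∉ {a | ¬ ∃ b, Bad a b}}
      = (W : Set (ℤ × ℤ)) := by
    ext a
    simp only [W, box, Set.mem_ofPred_eq, Finset.coe_filter, Finset.mem_product, Finset.mem_Icc,
      abs_le, not_not]
    tauto
  rw [hW, Set.ncard_coe_finset] at hlt
  have hWmem : ∀ a ∈ W, |a.1| ≤ (N : ℤ) ∧ |a.2| ≤ (N : ℤ) ∧ ∃ b, Bad a b := by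
    intro a ha
    have : a ∈ (W : Set (ℤ × ℤ)) := ha
    rw [← hW] at this
    simpa using this
  let β : ℤ × ℤ → ℤ × ℤ := fun a => if h : ∃ b, Bad a b then h.choose else a
  have hβ : ∀ a ∈ W, Bad a (β a) := by
    intro a ha
    have h := (hWmem a ha).2.2
    simp only [β, dif_pos h]
    exact h.choose_spec
  have : NeZero (p ^ k) := ⟨(pow_pos hppos k).ne'⟩
  have : NeZero p := ⟨hppos.ne'⟩
  let cl : ℤ × ℤ → (ZMod (p ^ k) × ZMod (p ^ k)) × (ZMod p × ZMod p) := fun a =>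
    (((a.1 : ZMod (p ^ k)), (a.2 : ZMod (p ^ k))), (((β a).1 : ZMod p), ((β a).2 : ZMod p)))
  have hcardT : (Finset.univ : Finset ((ZMod (p ^ k) × ZMod (p ^ k)) × (ZMod p × ZMod p))).card
      = (p ^ k) ^ 2 * p ^ 2 := by
    simp [ZMod.card, sq]
  have hbig : (Finset.univ : Finset ((ZMod (p ^ k) × ZMod (p ^ k)) × (ZMod p × ZMod p))).card
      * (D * (2 * (2 * L) + 1)) < W.card := by
    rw [hcardT]
    have h1 : (((p ^ k) ^ 2 * p ^ 2 * (D * (2 * (2 * L) + 1)) : ℕ) : ℝ) < W.card := by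
      refine lt_of_le_of_lt ?_ hlt
      have e1 : (p ^ k) ^ 2 * p ^ 2 * (D * (2 * (2 * L) + 1))
          ≤ (p ^ k) ^ 2 * H * (5 * p ^ 3 * D) := by
        calc (p ^ k) ^ 2 * p ^ 2 * (D * (2 * (2 * L) + 1))
            ≤ (p ^ k) ^ 2 * p ^ 2 * (D * (5 * L)) := by
              apply Nat.mul_le_mul_left
              apply Nat.mul_le_mul_left
              omega
          _ = (p ^ k) ^ 2 * H * (5 * p ^ 3 * D) := by rw [hL]; ring
      have e2 : (((p ^ k) ^ 2 * p ^ 2 * (D * (2 * (2 * L) + 1)) : ℕ) : ℝ)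
          ≤ (((p ^ k) ^ 2 * H * (5 * p ^ 3 * D) : ℕ) : ℝ) := by exact_mod_cast e1
      refine e2.trans ?_
      have e3 : ((p : ℝ) ^ k * H) ≤ N := by exact_mod_cast hq1'
      calc (((p ^ k) ^ 2 * H * (5 * p ^ 3 * D) : ℕ) : ℝ)
          = ((p : ℝ) ^ k) ^ 2 * H * ((5 * p ^ 3 * D : ℕ) : ℝ) := by push_cast; ring
        _ ≤ ((p : ℝ) ^ k) ^ 2 * H * (ε * H) := by
            apply mul_le_mul_of_nonneg_left hHε; positivity
        _ = ε * ((p : ℝ) ^ k * H) ^ 2 := by ring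
        _ ≤ ε * (N : ℝ) ^ 2 := by gcongr
    exact_mod_cast h1
  obtain ⟨t, -, ht⟩ := Finset.exists_lt_card_fiber_of_mul_lt_card_of_maps_to
    (f := cl) (fun a _ => Finset.mem_univ (cl a)) hbig
  obtain ⟨a₀, ha₀⟩ := Finset.card_pos.mp (lt_of_le_of_lt (Nat.zero_le _) ht)
  have ha₀' := (Finset.mem_filter.mp ha₀).2
  have hqN : (N : ℤ) < (p : ℤ) ^ k * L := by exact_mod_cast hq2'
  refine jm_class f g hJ V F G hF hG p hp hpu k L D ?_ ?_ ?_ hq48 _ β a₀ ha₀ ?_ ?_ ?_ ht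
  · exact (le_max_left _ _).trans (le_max_right _ _)
  · exact (le_max_right _ _).trans (le_max_right _ _)
  · exact le_max_left _ _
  · intro a ha
    have h := hβ a (Finset.mem_filter.mp ha).1
    exact ⟨h.1, h.2.1.1, h.2.1.2⟩
  · intro a ha
    have h : cl a = cl a₀ := (Finset.mem_filter.mp ha).2.trans ha₀'.symm
    simp only [cl, Prod.mk.injEq] at h
    obtain ⟨⟨h1, h2⟩, h3, h4⟩ := h
    refine ⟨?_, ?_, ?_, ?_⟩
    · have := (ZMod.intCast_eq_intCast_iff_dvd_sub _ _ _).mp h1.symm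
      exact_mod_cast this
    · have := (ZMod.intCast_eq_intCast_iff_dvd_sub _ _ _).mp h2.symm
      exact_mod_cast this
    · exact (ZMod.intCast_eq_intCast_iff_dvd_sub _ _ _).mp h3.symm
    · exact (ZMod.intCast_eq_intCast_iff_dvd_sub _ _ _).mp h4.symm
  · intro a ha
    have haW := (Finset.mem_filter.mp ha).1
    obtain ⟨h1, h2, -⟩ := hWmem a haW
    have h3 := (hβ a haW).2.2.trans (max_le h1 h2)
    exact ⟨h1.trans_lt hqN, h2.trans_lt hqN, ((le_max_left _ _).trans h3).trans_lt hqN,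
      ((le_max_right _ _).trans h3).trans_lt hqN⟩
end

section
/- Let Q : ℂ² → ℂ² be a polynomial map with J(Q) identically equal to 1. Suppose Q has finite order, i.e., there exists a positive integer t with Qᵗ equal to the identity map. Then Q has a fixed point: there exists (a,b) ∈ ℂ² with Q(a,b) = (a,b). -/
open MvPolynomial

lemma deriv_aeval {K B M : Type*} [CommRing K] [CommRing B] [Algebra K B] [AddCommGroup M]
    [Module B M] [Module K M] [IsScalarTower K B M] (D : Derivation K B M) (h : Fin 2 → B)
    (P : MvPolynomial (Fin 2) K) :
    D (aeval h P) = ∑ k, aeval h (pderiv k P) • D (h k) := by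
  induction P using MvPolynomial.induction_on with
  | C a => simp
  | add p q hp hq => simp [hp, hq, add_smul, Finset.sum_add_distrib]
  | mul_X p i hp =>
    fin_cases i <;>
    · simp [hp, pderiv_X, Pi.single_apply, add_smul, smul_smul, smul_add]
      try ring_nf
      try abel

lemma eval_chain {K : Type*} [CommRing K] (G H : Fin 2 → MvPolynomial (Fin 2) K)
    (z : Fin 2 → K) :
    (Matrix.of fun i j : Fin 2 => eval z (pderiv j (bind₁ H (G i)))) =
    (Matrix.of fun i j : Fin 2 => eval (fun k => eval z (H k)) (pderiv j (G i))) *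
    (Matrix.of fun i j : Fin 2 => eval z (pderiv j (H i))) := by
  ext i j
  have := deriv_aeval (pderiv j) H (G i)
  simp only [Matrix.of_apply, Matrix.mul_apply]
  rw [show bind₁ H (G i) = aeval H (G i) from rfl, this, map_sum]
  refine Finset.sum_congr rfl fun k _ => ?_
  rw [smul_eq_mul, map_mul]
  congr 1
  rw [show eval z ((aeval H) (pderiv k (G i))) = _ from eval₂Hom_bind₁ (RingHom.id K) z H _]
  rfl

lemma unram {K : Type} [Field K] [IsAlgClosed K] (u : Fin 2 → MvPolynomial (Fin 2) K)
    (hu : ∀ z : Fin 2 → K, (∀ i, eval z (u i) = 0) →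
      eval z (Matrix.of fun i j : Fin 2 => pderiv j (u i)).det ≠ 0) :
    Algebra.FormallyUnramified K (MvPolynomial (Fin 2) K ⧸ Ideal.span (Set.range u)) := by
  set I := Ideal.span (Set.range u) with hI
  set d := (Matrix.of fun i j : Fin 2 => pderiv j (u i)).det with hd
  have hunit : IsUnit (Ideal.Quotient.mk I d) := by
    by_contra hn
    obtain ⟨m, hm, hdm⟩ := exists_max_ideal_of_mem_nonunits hn
    have hm' : (m.comap (Ideal.Quotient.mk I)).IsMaximal :=
      Ideal.comap_isMaximal_of_surjective _ Ideal.Quotient.mk_surjective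
    obtain ⟨z, hz⟩ := isMaximal_iff_eq_vanishingIdeal_singleton.mp hm'
    have key : ∀ p, Ideal.Quotient.mk I p ∈ m ↔ eval z p = 0 := by
      intro p
      rw [← Ideal.mem_comap, hz, mem_vanishingIdeal_singleton_iff]
      rfl
    refine hu z (fun i => ?_) ((key d).1 hdm)
    rw [← key, Ideal.Quotient.eq_zero_iff_mem.mpr]
    · exact m.zero_mem
    · exact Ideal.subset_span ⟨i, rfl⟩
  let D := KaehlerDifferential.D K (MvPolynomial (Fin 2) K ⧸ I)
  let h : Fin 2 → (MvPolynomial (Fin 2) K ⧸ I) := fun i => Ideal.Quotient.mk I (X i)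
  have hh : ∀ P, aeval h P = Ideal.Quotient.mk I P := by
    intro P
    have : aeval h = Ideal.Quotient.mkₐ K I := by
      ext i; simp [h]
    rw [this]; rfl
  have h0 : ∀ i, ∑ k, Ideal.Quotient.mk I (pderiv k (u i)) • D (h k) = 0 := by
    intro i
    have := deriv_aeval D h (u i)
    rw [hh, Ideal.Quotient.eq_zero_iff_mem.mpr (Ideal.subset_span (Set.mem_range_self i)), map_zero] at this
    simp only [hh] at this
    exact this.symm
  have hX : ∀ k, D (h k) = 0 := by
    intro k
    rw [← hunit.smul_eq_zero]
    have e0 := h0 0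
    have e1 := h0 1
    simp only [Fin.sum_univ_two] at e0 e1
    rw [hd, Matrix.det_fin_two]
    simp only [Matrix.of_apply, map_sub, map_mul]
    generalize (Ideal.Quotient.mk I) ((pderiv 0) (u 0)) = a at *
    generalize (Ideal.Quotient.mk I) ((pderiv 1) (u 0)) = b at *
    generalize (Ideal.Quotient.mk I) ((pderiv 0) (u 1)) = c at *
    generalize (Ideal.Quotient.mk I) ((pderiv 1) (u 1)) = e at *
    fin_cases k
    · have : (a * e - b * c) • D (h 0) = e • (a • D (h 0) + b • D (h 1)) - b • (c • D (h 0) + e • D (h 1)) := by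
        module
      simpa [e0, e1] using this
    · have : (a * e - b * c) • D (h 1) = a • (c • D (h 0) + e • D (h 1)) - c • (a • D (h 0) + b • D (h 1)) := by
        module
      simpa [e0, e1] using this
  constructor
  have hD : ∀ x, D x = 0 := by
    intro x
    obtain ⟨P, rfl⟩ := Ideal.Quotient.mk_surjective x
    rw [← hh, deriv_aeval]
    simp [hX]
  rw [← Submodule.subsingleton_iff (MvPolynomial (Fin 2) K ⧸ I), ← subsingleton_iff_bot_eq_top, ← KaehlerDifferential.span_range_derivation, eq_comm, Submodule.span_eq_bot]
  rintro _ ⟨x, rfl⟩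
  exact hD x

lemma zeros {K : Type} [Field K] [IsAlgClosed K] (u : Fin 2 → MvPolynomial (Fin 2) K)
    (hu : ∀ z : Fin 2 → K, (∀ i, eval z (u i) = 0) →
      eval z (Matrix.of fun i j : Fin 2 => pderiv j (u i)).det ≠ 0) :
    Finite {z : Fin 2 → K // ∀ i, eval z (u i) = 0} ∧
    Nat.card {z : Fin 2 → K // ∀ i, eval z (u i) = 0} =
      Module.finrank K (MvPolynomial (Fin 2) K ⧸ Ideal.span (Set.range u)) := by
  have := unram u hu
  set I := Ideal.span (Set.range u) with hI
  have := Algebra.FormallyEtale.of_formallyUnramified_of_field K (MvPolynomial (Fin 2) K ⧸ I)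
  have := Algebra.FormallyUnramified.finite_of_free K (MvPolynomial (Fin 2) K ⧸ I)
  have : IsArtinianRing (MvPolynomial (Fin 2) K ⧸ I) := isArtinian_of_tower K inferInstance
  let e := Algebra.FormallyEtale.equivPiOfIsSepClosed K (MvPolynomial (Fin 2) K ⧸ I)
  have hfin : Finite (PrimeSpectrum (MvPolynomial (Fin 2) K ⧸ I)) := inferInstance
  have hr : Module.finrank K (MvPolynomial (Fin 2) K ⧸ I) = Nat.card (PrimeSpectrum (MvPolynomial (Fin 2) K ⧸ I)) := by
    have := Fintype.ofFinite (PrimeSpectrum (MvPolynomial (Fin 2) K ⧸ I))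
    rw [e.toLinearEquiv.finrank_eq, Module.finrank_fintype_fun_eq_card, Nat.card_eq_fintype_card]
  have hker : ∀ z : {z : Fin 2 → K // ∀ i, eval z (u i) = 0}, I ≤ RingHom.ker (eval z.1) := by
    intro z
    rw [hI, Ideal.span_le]
    rintro _ ⟨i, rfl⟩
    exact z.2 i
  let F : {z : Fin 2 → K // ∀ i, eval z (u i) = 0} → PrimeSpectrum (MvPolynomial (Fin 2) K ⧸ I) :=
    fun z => ⟨RingHom.ker (Ideal.Quotient.lift I (eval z.1) fun a ha => hker z ha), RingHom.ker_isPrime _⟩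
  have hF : ∀ z p, Ideal.Quotient.mk I p ∈ (F z).asIdeal ↔ eval z.1 p = 0 := by
    intro z p
    exact Iff.rfl
  have hbij : Function.Bijective F := by
    constructor
    · intro z w hzw
      ext i
      have := hF z (X i - C (z.1 i))
      rw [hzw, hF] at this
      simp at this
      exact (sub_eq_zero.mp this).symm
    · intro P
      have hmax : P.asIdeal.IsMaximal := inferInstance
      have hm' : (P.asIdeal.comap (Ideal.Quotient.mk I)).IsMaximal :=
        Ideal.comap_isMaximal_of_surjective _ Ideal.Quotient.mk_surjective
      obtain ⟨z, hz⟩ := isMaximal_iff_eq_vanishingIdeal_singleton.mp hm'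
      have key : ∀ p, Ideal.Quotient.mk I p ∈ P.asIdeal ↔ eval z p = 0 := by
        intro p
        rw [← Ideal.mem_comap, hz, mem_vanishingIdeal_singleton_iff]
        rfl
      refine ⟨⟨z, fun i => ?_⟩, ?_⟩
      · rw [← key, Ideal.Quotient.eq_zero_iff_mem.mpr]
        · exact P.asIdeal.zero_mem
        · exact Ideal.subset_span ⟨i, rfl⟩
      · ext x
        obtain ⟨p, rfl⟩ := Ideal.Quotient.mk_surjective x
        rw [hF, key]
  exact ⟨Finite.of_injective F hbij.1, by rw [hr, Nat.card_eq_of_bijective F hbij]⟩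


def LowDeg {K : Type} [Field K] (N : ℕ) (a : MvPolynomial (Fin 2) K) : Prop :=
  ∀ m : Fin 2 →₀ ℕ, N ≤ m.degree → coeff m a = 0

lemma LowDeg.add {K : Type} [Field K] {N : ℕ} {a b : MvPolynomial (Fin 2) K}
    (ha : LowDeg N a) (hb : LowDeg N b) : LowDeg N (a + b) := fun m hm => by
  rw [coeff_add, ha m hm, hb m hm, add_zero]

lemma LowDeg.sub {K : Type} [Field K] {N : ℕ} {a b : MvPolynomial (Fin 2) K}
    (ha : LowDeg N a) (hb : LowDeg N b) : LowDeg N (a - b) := fun m hm => by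
  rw [coeff_sub, ha m hm, hb m hm, sub_zero]

lemma LowDeg.mul {K : Type} [Field K] {s t : ℕ} {a b : MvPolynomial (Fin 2) K}
    (ha : LowDeg (s + 1) a) (hb : LowDeg t b) : LowDeg (s + t) (a * b) := fun m hm => by
  rw [coeff_mul]
  refine Finset.sum_eq_zero fun x hx => ?_
  rw [Finset.HasAntidiagonal.mem_antidiagonal] at hx
  rw [← hx, map_add] at hm
  by_cases h : s + 1 ≤ x.1.degree
  · rw [ha _ h, zero_mul]
  · rw [hb _ (by omega), mul_zero]

lemma LowDeg.mul' {K : Type} [Field K] {N q : ℕ} {a b : MvPolynomial (Fin 2) K}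
    (ha : ∀ x, coeff x a ≠ 0 → x.degree + q = N) (hb : LowDeg q b) : LowDeg N (a * b) := fun m hm => by
  rw [coeff_mul]
  refine Finset.sum_eq_zero fun x hx => ?_
  rw [Finset.HasAntidiagonal.mem_antidiagonal] at hx
  rw [← hx, map_add] at hm
  by_cases h : coeff x.1 a = 0
  · rw [h, zero_mul]
  · have := ha _ h
    rw [hb _ (by omega), mul_zero]

lemma lowDeg_X_pow {K : Type} [Field K] (q : ℕ) (i : Fin 2) :
    LowDeg (q + 1) (X i ^ q : MvPolynomial (Fin 2) K) := fun m hm => by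
  rw [coeff_X_pow, if_neg]
  rintro rfl
  simp at hm

lemma red_zero {K : Type} [Field K] (q : ℕ) (f : Fin 2 → MvPolynomial (Fin 2) K)
    (hf : ∀ i, LowDeg q (f i)) (N : ℕ) : ∀ a b : MvPolynomial (Fin 2) K,
    LowDeg N a → LowDeg N b →
    (∀ m : Fin 2 →₀ ℕ, (∃ i, q ≤ m i) → coeff m (a * (X 0 ^ q - f 0) + b * (X 1 ^ q - f 1)) = 0) →
    a * (X 0 ^ q - f 0) + b * (X 1 ^ q - f 1) = 0 := by
  induction N with
  | zero =>
    intro a b ha hb _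
    have ha' : a = 0 := by ext m; exact ha m (Nat.zero_le _)
    have hb' : b = 0 := by ext m; exact hb m (Nat.zero_le _)
    simp [ha', hb']
  | succ N ih =>
    intro a b ha hb hP
    have key : ∀ a : MvPolynomial (Fin 2) K, LowDeg (N + 1) a → LowDeg N (a - homogeneousComponent N a) := by
      intro a ha m hm
      rw [coeff_sub, coeff_homogeneousComponent]
      split_ifs with h
      · simp
      · rw [ha m (by omega), sub_zero]
    have ha' := key a ha
    have hb' := key b hb
    have haN := homogeneousComponent_isHomogeneous N a
    have hbN := homogeneousComponent_isHomogeneous N b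
    set aN := homogeneousComponent N a
    set bN := homogeneousComponent N b
    have hH : (aN * X 0 ^ q + bN * X 1 ^ q).IsHomogeneous (N + q) :=
      (haN.mul (isHomogeneous_X_pow _ _)).add (hbN.mul (isHomogeneous_X_pow _ _))
    have hR : LowDeg (N + q) ((X 0 ^ q * (a - aN) + X 1 ^ q * (b - bN)) - (a * f 0 + b * f 1)) := by
      refine LowDeg.sub ?_ ((ha.mul (hf 0)).add (hb.mul (hf 1)))
      rw [add_comm N q]
      exact ((lowDeg_X_pow q 0).mul ha').add ((lowDeg_X_pow q 1).mul hb')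
    have hPe : a * (X 0 ^ q - f 0) + b * (X 1 ^ q - f 1) = (aN * X 0 ^ q + bN * X 1 ^ q) +
      ((X 0 ^ q * (a - aN) + X 1 ^ q * (b - bN)) - (a * f 0 + b * f 1)) := by ring
    have hH0 : aN * X 0 ^ q + bN * X 1 ^ q = 0 := by
      ext m
      rw [coeff_zero]
      by_cases hm : m.degree = N + q
      · by_cases hi : ∃ i, q ≤ m i
        · have := hP m hi
          rw [hPe, coeff_add, hR m hm.ge, add_zero] at this
          exact this
        · push Not at hi
          have h0 := hi 0
          have h1 := hi 1
          rw [coeff_add, X_pow_eq_monomial, X_pow_eq_monomial, coeff_mul_monomial', coeff_mul_monomial',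
            if_neg, if_neg, add_zero]
          · simp; omega
          · simp; omega
      · exact hH.coeff_eq_zero hm
    have hdvd : (X 1 ^ q : MvPolynomial (Fin 2) K) ∣ aN := by
      have h1 : (X 1 ^ q : MvPolynomial (Fin 2) K) ∣ X 0 ^ q * aN := 
        ⟨-bN, by linear_combination hH0⟩
      refine (X_prime (R := K) (σ := Fin 2) (i := 1)).pow_dvd_of_dvd_mul_left q ?_ h1
      intro h
      have := (X_prime (R := K) (σ := Fin 2) (i := 1)).dvd_of_dvd_pow h
      simp [X_dvd_X] at this
    obtain ⟨c, hc⟩ := hdvd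
    have hbc : bN = - (c * X 0 ^ q) := by
      have : (X 1 ^ q : MvPolynomial (Fin 2) K) ≠ 0 := pow_ne_zero _ (X_ne_zero _)
      apply mul_left_cancel₀ this
      linear_combination hH0 - X 0 ^ q * hc
    have hcd : ∀ x, coeff x c ≠ 0 → x.degree + q = N := by
      intro x hx
      have h2 : coeff (Finsupp.single 1 q + x) aN = coeff x c := by
        rw [hc, X_pow_eq_monomial, coeff_monomial_mul, one_mul]
      rw [← h2] at hx
      have := haN hx
      have h3 : (Finsupp.single (1 : Fin 2) q + x).degree = N := by
        rw [← this, Finsupp.degree_eq_weight_one]; rfl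
      simp at h3
      omega
    have e : a * (X 0 ^ q - f 0) + b * (X 1 ^ q - f 1) =
      ((a - aN) + c * f 1) * (X 0 ^ q - f 0) + ((b - bN) - c * f 0) * (X 1 ^ q - f 1) := by
      linear_combination (X 0 ^ q - f 0) * hc + (X 1 ^ q - f 1) * hbc
    rw [e] at hP ⊢
    exact ih _ _ (ha'.add (LowDeg.mul' hcd (hf 1))) (hb'.sub (LowDeg.mul' hcd (hf 0))) hP

lemma exists_lowDeg {K : Type} [Field K] (a : MvPolynomial (Fin 2) K) : LowDeg (a.totalDegree + 1) a := by
  intro m hm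
  by_contra h
  have := le_totalDegree (mem_support_iff.mpr h)
  have h2 : m.degree ≤ a.totalDegree := this
  omega

lemma LowDeg.mono {K : Type} [Field K] {M N : ℕ} (h : M ≤ N) {a : MvPolynomial (Fin 2) K} (ha : LowDeg M a) :
    LowDeg N a := fun m hm => ha m (h.trans hm)

lemma dim_q {K : Type} [Field K] (q : ℕ) (f : Fin 2 → MvPolynomial (Fin 2) K)
    (hf : ∀ i, LowDeg q (f i)) (u : Fin 2 → MvPolynomial (Fin 2) K) (hu : ∀ i, u i = X i ^ q - f i) :
    Module.finrank K (MvPolynomial (Fin 2) K ⧸ Ideal.span (Set.range u)) = q ^ 2 := by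
  set I := Ideal.span (Set.range u) with hI
  let s : Set (Fin 2 →₀ ℕ) := {m | ∀ i, m i < q}
  let L : restrictSupport K s →ₗ[K] (MvPolynomial (Fin 2) K ⧸ I) :=
    (Ideal.Quotient.mkₐ K I).toLinearMap.comp (Submodule.subtype _)
  have hL : ∀ x, L x = Ideal.Quotient.mk I x.1 := fun x => rfl
  have hinj : Function.Injective L := by
    rw [injective_iff_map_eq_zero]
    rintro ⟨x, hx⟩ h
    rw [hL, Ideal.Quotient.eq_zero_iff_mem, hI] at h
    have hr : Set.range u = {u 0, u 1} := by
      ext y; simp [Fin.exists_fin_two, eq_comm]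
    rw [hr, Ideal.mem_span_pair] at h
    obtain ⟨a, b, hab⟩ := h
    simp only [hu] at hab
    have := red_zero q f hf (max (a.totalDegree + 1) (b.totalDegree + 1)) a b
      ((exists_lowDeg a).mono (le_max_left _ _)) ((exists_lowDeg b).mono (le_max_right _ _)) ?_
    · apply Subtype.ext
      change x = 0
      rw [← hab]; exact this
    · rintro m ⟨i, hi⟩
      rw [hab]
      by_contra hne
      have := (mem_restrictSupport_iff K).1 hx (mem_support_iff.mpr hne)
      exact absurd (this i) (by omega)
  have hsurj : Function.Surjective L := by
    have main : ∀ N, ∀ P, LowDeg N P → Ideal.Quotient.mk I P ∈ LinearMap.range L := by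
      intro N
      induction N with
      | zero =>
        intro P hP
        have : P = 0 := by ext m; exact hP m (Nat.zero_le _)
        rw [this, map_zero]; exact Submodule.zero_mem _
      | succ N ih =>
        intro P hP
        rw [P.as_sum, map_sum]
        refine Submodule.sum_mem _ fun m hm => ?_
        have hmN : m.degree ≤ N := by
          by_contra h
          exact (mem_support_iff.mp hm) (hP m (by omega))
        generalize coeff m P = c
        by_cases hms : m ∈ s
        · refine ⟨⟨monomial m c, ?_⟩, rfl⟩
          rw [mem_restrictSupport_iff]
          intro k hk
          have := support_monomial_subset hk
          simp at this
          rw [this]; exact hms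
        · simp only [s, Set.mem_ofPred_eq, not_forall, not_lt] at hms
          obtain ⟨i, hi⟩ := hms
          have hle : Finsupp.single i q ≤ m := by simpa using hi
          have e : Ideal.Quotient.mk I (monomial m c) = Ideal.Quotient.mk I (monomial (m - Finsupp.single i q) c * f i) := by
            rw [Ideal.Quotient.eq]
            have : monomial m c - monomial (m - Finsupp.single i q) c * f i = monomial (m - Finsupp.single i q) c * u i := by
              rw [hu, mul_sub, X_pow_eq_monomial, monomial_mul, mul_one, tsub_add_cancel_of_le hle]
            rw [this]
            exact Ideal.mul_mem_left _ _ (Ideal.subset_span ⟨i, rfl⟩)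
          rw [e]
          apply ih
          have hd : (m - Finsupp.single i q).degree + q = m.degree := by
            conv_rhs => rw [← tsub_add_cancel_of_le hle]
            simp
          refine LowDeg.mono hmN (LowDeg.mul' (q := q) ?_ (hf i))
          intro x hx
          rw [coeff_monomial] at hx
          split_ifs at hx with h
          · rw [← h]; exact hd
          · simp at hx
    intro x
    obtain ⟨P, rfl⟩ := Ideal.Quotient.mk_surjective x
    exact main _ P (exists_lowDeg P)
  rw [← (LinearEquiv.ofBijective L ⟨hinj, hsurj⟩).finrank_eq, Module.finrank_eq_nat_card_basis (basisRestrictSupport K s)]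
  let e : s ≃ (Fin 2 → Fin q) :=
    { toFun := fun m i => ⟨m.1 i, m.2 i⟩
      invFun := fun g => ⟨Finsupp.equivFunOnFinite.symm fun i => (g i : ℕ), fun i => by simp⟩
      left_inv := fun m => by ext i; simp
      right_inv := fun g => by ext i; simp }
  rw [Nat.card_congr e]
  simp

/-- The map on points given by a pair of polynomials. -/
noncomputable def pmap {K : Type*} [CommRing K] (G : Fin 2 → MvPolynomial (Fin 2) K) (z : Fin 2 → K) :
    Fin 2 → K := fun i => eval z (G i)

/-- Iterates of a polynomial map, as pairs of polynomials. -/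
noncomputable def pit {K : Type*} [CommRing K] (G : Fin 2 → MvPolynomial (Fin 2) K) :
    ℕ → Fin 2 → MvPolynomial (Fin 2) K
  | 0 => X
  | k + 1 => fun i => bind₁ (pit G k) (G i)

/-- The Jacobian matrix at a point. -/
noncomputable def jac {K : Type*} [CommRing K] (G : Fin 2 → MvPolynomial (Fin 2) K) (z : Fin 2 → K) :
    Matrix (Fin 2) (Fin 2) K := Matrix.of fun i j : Fin 2 => eval z (pderiv j (G i))

lemma eval_bind {K : Type*} [CommRing K] (H : Fin 2 → MvPolynomial (Fin 2) K)
    (z : Fin 2 → K) (P : MvPolynomial (Fin 2) K) : eval z (bind₁ H P) = eval (pmap H z) P :=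
  eval₂Hom_bind₁ (RingHom.id K) z H _

lemma pmap_pit {K : Type*} [CommRing K] (G : Fin 2 → MvPolynomial (Fin 2) K) (k : ℕ) (z : Fin 2 → K) :
    pmap (pit G k) z = (pmap G)^[k] z := by
  induction k with
  | zero => ext i; simp [pmap, pit]
  | succ k ih =>
    rw [Function.iterate_succ_apply', ← ih]
    ext i
    simp only [pmap, pit]
    rw [eval_bind]

lemma jac_X {K : Type*} [CommRing K] (z : Fin 2 → K) :
    jac (X : Fin 2 → MvPolynomial (Fin 2) K) z = 1 := by
  ext i j
  simp [jac, pderiv_X, Pi.single_apply, Matrix.one_apply]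

lemma jac_pit_succ {K : Type*} [CommRing K] (G : Fin 2 → MvPolynomial (Fin 2) K) (k : ℕ) (z : Fin 2 → K) :
    jac (pit G (k + 1)) z = jac G ((pmap G)^[k] z) * jac (pit G k) z := by
  rw [← pmap_pit]
  exact eval_chain G (pit G k) z

lemma det_jac_pit {K : Type*} [CommRing K] (G : Fin 2 → MvPolynomial (Fin 2) K)
    (hG : ∀ z, (jac G z).det = 1) (k : ℕ) (z : Fin 2 → K) : (jac (pit G k) z).det = 1 := by
  induction k with
  | zero => simp [pit, jac_X]
  | succ k ih => rw [jac_pit_succ, Matrix.det_mul, hG, ih, one_mul]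

lemma jac_pit_fixed {K : Type*} [CommRing K] (G : Fin 2 → MvPolynomial (Fin 2) K) (z : Fin 2 → K)
    (hz : pmap G z = z) (k : ℕ) : jac (pit G k) z = jac G z ^ k := by
  induction k with
  | zero => simp [pit, jac_X]
  | succ k ih => rw [jac_pit_succ, Function.iterate_fixed hz, ih, pow_succ']

lemma taylor {K : Type*} [Field K] (z : Fin 2 → K) (P : MvPolynomial (Fin 2) K) :
    P - C (eval z P) - ∑ k, C (eval z (pderiv k P)) * (X k - C (z k)) ∈ RingHom.ker (eval z) ^ 2 := by
  have hX : ∀ k, (X k - C (z k)) ∈ RingHom.ker (eval z) := by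
    intro k; simp [RingHom.mem_ker]
  induction P using MvPolynomial.induction_on with
  | C a => simp
  | add p q hp hq =>
    convert Ideal.add_mem _ hp hq using 1
    simp [add_mul, Finset.sum_add_distrib]
    ring
  | mul_X p i hp =>
    have h2 : (∑ k, C (eval z (pderiv k p)) * (X k - C (z k))) * (X i - C (z i)) ∈ RingHom.ker (eval z) ^ 2 := by
      rw [pow_two]
      refine Ideal.mul_mem_mul (Ideal.sum_mem _ fun k _ => Ideal.mul_mem_left _ _ (hX k)) (hX i)
    convert Ideal.add_mem _ (Ideal.mul_mem_left _ (X i) hp) h2 using 1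
    fin_cases i <;>
    · simp [pderiv_X, Pi.single_apply]
      ring

lemma isolated {K : Type*} [Field K] [Infinite K] (T : Fin 2 → MvPolynomial (Fin 2) K) (l : ℕ)
    (hl : (l : K) ≠ 0) (hT : (pmap T)^[l] = id) (z : Fin 2 → K) (hz : pmap T z = z)
    (hdet : (jac T z).det = 1) (hdet' : (jac T z - 1).det = 0) : ∀ w, pmap T w = w := by
  have hpit : pit T l = X := by
    ext1 i
    apply MvPolynomial.funext
    intro w
    have := congrFun (pmap_pit T l w) i
    rw [hT] at this
    simpa [pmap] using this
  have hM : jac T z ^ l = 1 := by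
    rw [← jac_pit_fixed T z hz, hpit, jac_X]
  have hM1 : jac T z = 1 := by
    generalize jac T z = M at *
    have hN2 : (M - 1) * (M - 1) = 0 := by
      rw [Matrix.det_fin_two] at hdet hdet'
      simp at hdet'
      have htr : M 0 0 + M 1 1 = 2 := by linear_combination hdet - hdet'
      ext i j
      fin_cases i <;> fin_cases j <;> simp [Matrix.mul_apply, Fin.sum_univ_two]
      · linear_combination (M 0 0) * htr - hdet
      · linear_combination (M 0 1) * htr
      · linear_combination (M 1 0) * htr
      · linear_combination (M 1 1) * htr - hdet
    have hp : ∀ k : ℕ, M ^ k = 1 + (k : K) • (M - 1) := by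
      intro k
      induction k with
      | zero => simp
      | succ k ih =>
        rw [pow_succ, ih]
        have : (1 + (k : K) • (M - 1)) * M = 1 + ((k + 1 : ℕ) : K) • (M - 1) + (k : K) • ((M - 1) * (M - 1)) := by
          simp only [add_mul, sub_mul, mul_sub, smul_mul_assoc, one_mul, mul_one]
          push_cast
          module
        rw [this, hN2, smul_zero, add_zero]
    rw [hp l] at hM
    have : (l : K) • (M - 1) = 0 := by simpa using hM
    have := (smul_eq_zero.mp this).resolve_left hl
    exact sub_eq_zero.mp this
  set m := RingHom.ker (eval z) with hm
  let φ : MvPolynomial (Fin 2) K →ₐ[K] MvPolynomial (Fin 2) K := bind₁ T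
  have hφ : ∀ k P w, eval w (φ^[k] P) = eval ((pmap T)^[k] w) P := by
    intro k
    induction k with
    | zero => intro P w; rfl
    | succ k ih =>
      intro P w
      rw [Function.iterate_succ_apply, ih, Function.iterate_succ_apply']
      exact eval_bind T _ P
  have hφl : ∀ P, φ^[l] P = P := by
    intro P
    apply MvPolynomial.funext
    intro w
    rw [hφ, hT]; rfl
  have hX : ∀ i, φ (X i) - X i ∈ m ^ 2 := by
    intro i
    have h1 := taylor z (T i)
    have h2 : ∀ k, eval z (pderiv k (T i)) = (1 : Matrix (Fin 2) (Fin 2) K) i k := by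
      intro k; rw [← hM1]; rfl
    have h3 : eval z (T i) = z i := congrFun hz i
    simp only [h2, h3] at h1
    convert h1 using 1
    simp only [φ, bind₁_X_right]
    rw [Finset.sum_eq_single i]
    · simp
    · intro k _ hk
      rw [Matrix.one_apply_ne (Ne.symm hk)]; simp
    · simp
  have hδ : ∀ P, φ P - P ∈ m ^ 2 := by
    intro P
    induction P using MvPolynomial.induction_on with
    | C a => simp [φ]
    | add p q hp hq =>
      rw [map_add, add_sub_add_comm]; exact Ideal.add_mem _ hp hq
    | mul_X p i hp =>
      rw [map_mul]
      have : φ p * φ (X i) - p * X i = φ (X i) * (φ p - p) + p * (φ (X i) - X i) := by ring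
      rw [this]
      exact Ideal.add_mem _ (Ideal.mul_mem_left _ _ hp) (Ideal.mul_mem_left _ _ (hX i))
  have hδj : ∀ j, ∀ P ∈ m ^ j, φ P - P ∈ m ^ (j + 1) := by
    intro j
    induction j with
    | zero => intro P _; exact Ideal.pow_le_pow_right (by norm_num) (hδ P)
    | succ j ih =>
      intro P hP
      rw [pow_succ] at hP
      refine Submodule.mul_induction_on hP ?_ ?_
      · intro a ha b hb
        have : φ (a * b) - a * b = (φ a - a) * φ b + a * (φ b - b) := by rw [map_mul]; ring
        rw [this]
        refine Ideal.add_mem _ ?_ ?_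
        · rw [pow_succ]
          refine Ideal.mul_mem_mul (ih a ha) ?_
          have h5 : φ b = (φ b - b) + b := by ring
          rw [h5]
          exact Ideal.add_mem _ (Ideal.pow_le_self (by norm_num) (hδ b)) hb
        · rw [add_assoc, pow_add]
          exact Ideal.mul_mem_mul ha (hδ b)
      · intro a b ha hb
        rw [map_add, add_sub_add_comm]; exact Ideal.add_mem _ ha hb
  have hall : ∀ k, ∀ P, φ P - P ∈ m ^ k := by
    intro k
    induction k with
    | zero => intro P; simp
    | succ k ih =>
      intro P
      have hr : ∀ r : ℕ, φ^[r] P - P - C (r : K) * (φ P - P) ∈ m ^ (k + 1) := by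
        intro r
        induction r with
        | zero => simp
        | succ r ihr =>
          rw [Function.iterate_succ_apply']
          set e := φ^[r] P - P - C (r : K) * (φ P - P) with he
          have h6 : φ^[r] P = P + C (r : K) * (φ P - P) + e := by rw [he]; ring
          have hC : φ (C (r : K)) = C (r : K) := by simp [φ]
          have h7 : φ (φ^[r] P) - P - C ((r + 1 : ℕ) : K) * (φ P - P) =
            C (r : K) * (φ (φ P - P) - (φ P - P)) + ((φ e - e) + e) := by
            rw [h6, map_add, map_add, map_mul, hC]
            push_cast
            rw [map_add, C_1]
            ring
          rw [h7]
          refine Ideal.add_mem _ (Ideal.mul_mem_left _ _ (hδj k _ (ih P))) (Ideal.add_mem _ ?_ ihr)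
          exact Ideal.pow_le_pow_right (by omega) (hδj (k + 1) _ ihr)
      have h8 := hr l
      rw [hφl, sub_self, zero_sub] at h8
      have h9 := Ideal.mul_mem_left _ (C (-(l : K)⁻¹)) h8
      have h10 : C (-(l : K)⁻¹) * -(C (l : K) * (φ P - P)) = φ P - P := by
        have : (C (l : K)⁻¹ : MvPolynomial (Fin 2) K) * C (l : K) = 1 := by
          rw [← C_mul, inv_mul_cancel₀ hl, C_1]
        rw [C_neg]
        linear_combination (φ P - P) * this
      rwa [h10] at h9
  have hmtop : m ≠ ⊤ := RingHom.ker_ne_top _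
  have hbot := Ideal.iInf_pow_eq_bot_of_isDomain m hmtop
  intro w
  ext i
  have h11 : φ (X i) - X i ∈ (⨅ k : ℕ, m ^ k) := by
    rw [Ideal.mem_iInf]; exact fun k => hall k _
  rw [hbot, Ideal.mem_bot, sub_eq_zero] at h11
  have := congrArg (eval w) h11
  simpa [φ, pmap] using this

lemma exists_q {K : Type} [Field K] (p : ℕ) (hp : p.Prime)
    (halg : ∀ a : K, ∃ m, 0 < m ∧ a ^ (p ^ m) = a) (s : Finset K) (D : ℕ) :
    ∃ m, 0 < m ∧ D < p ^ m ∧ ∀ a ∈ s, a ^ (p ^ m) = a := by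
  choose e he h using halg
  have hit : ∀ a r, a ^ (p ^ (e a * r)) = a := by
    intro a r
    induction r with
    | zero => simp
    | succ r ih => rw [mul_add, mul_one, pow_add, pow_mul, ih, h]
  have hE : 0 < ∏ a ∈ s, e a := Finset.prod_pos fun a _ => he a
  refine ⟨(∏ a ∈ s, e a) * (D + 1), by positivity, ?_, ?_⟩
  · have h1 := Nat.lt_pow_self (n := (∏ a ∈ s, e a) * (D + 1)) hp.one_lt
    have h2 : D + 1 ≤ (∏ a ∈ s, e a) * (D + 1) := Nat.le_mul_of_pos_left _ hE
    omega
  · intro a ha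
    obtain ⟨r, hr⟩ := Finset.dvd_prod_of_mem e ha
    rw [hr, mul_assoc]
    exact hit a _

lemma exists_prime_step {α : Type} (σ : α → α) (t : ℕ) (ht : t ≠ 0) (h : σ^[t] = id) (h1 : σ ≠ id) :
    ∃ k l : ℕ, l.Prime ∧ l ∣ t ∧ σ^[k] ≠ id ∧ (σ^[k])^[l] = id := by
  classical
  have hex : ∃ d, d ∣ t ∧ σ^[d] = id := ⟨t, dvd_rfl, h⟩
  set d := Nat.find hex with hd
  obtain ⟨hdt, hdi⟩ := Nat.find_spec hex
  rw [← hd] at hdt hdi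
  have hd0 : d ≠ 0 := fun h0 => ht (by simpa [h0] using hdt)
  have hd1 : d ≠ 1 := by
    intro h0
    rw [h0] at hdi
    exact h1 (by simpa using hdi)
  have hl := Nat.minFac_prime hd1
  have hmul : d / d.minFac * d.minFac = d := Nat.div_mul_cancel (Nat.minFac_dvd d)
  refine ⟨d / d.minFac, d.minFac, hl, (Nat.minFac_dvd d).trans hdt, ?_, ?_⟩
  · intro hk
    refine Nat.find_min hex (m := d / d.minFac) ?_ ⟨(Nat.div_dvd_of_dvd (Nat.minFac_dvd d)).trans hdt, hk⟩
    exact Nat.div_lt_self (Nat.pos_of_ne_zero hd0) hl.one_lt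
  · rw [← Function.iterate_mul, hmul, hdi]

lemma main_K {K : Type} [Field K] [IsAlgClosed K] (p : ℕ) (hp : p.Prime) [CharP K p]
    (halg : ∀ a : K, ∃ m, 0 < m ∧ a ^ (p ^ m) = a) (G : Fin 2 → MvPolynomial (Fin 2) K)
    (hG : ∀ z, (jac G z).det = 1) (t : ℕ) (ht : (t : K) ≠ 0) (hord : (pmap G)^[t] = id) :
    ∃ z, pmap G z = z := by
  classical
  by_contra hno
  push Not at hno
  have : Infinite K := IsAlgClosed.instInfinite
  have : Fact p.Prime := ⟨hp⟩
  have ht0 : t ≠ 0 := by rintro rfl; simp at ht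
  obtain ⟨k, l, hl, hlt, hk, hkl⟩ := exists_prime_step (pmap G) t ht0 hord
    (fun h => hno 0 (congrFun h 0))
  have hlK : (l : K) ≠ 0 := by
    rintro h0
    obtain ⟨r, rfl⟩ := hlt
    apply ht
    push_cast
    rw [h0, zero_mul]
  have hTk : pmap (pit G k) = (pmap G)^[k] := funext (pmap_pit G k)
  -- the fixed points of the prime order element are finite in number
  have hfix : Finite {z : Fin 2 → K // ∀ i, eval z (pit G k i - X i) = 0} := by
    refine (zeros (fun i => pit G k i - X i) fun z hz h0 => ?_).1
    have hz' : pmap (pit G k) z = z := by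
      ext i
      have := hz i
      rw [map_sub, eval_X, sub_eq_zero] at this
      exact this
    apply hk
    rw [← hTk]
    refine funext (isolated (pit G k) l hlK (by rw [hTk]; exact hkl) z hz' (det_jac_pit G hG k z) ?_)
    rw [← h0, RingHom.map_det]
    congr 1
    rw [← jac_X z]
    ext i j
    simp [jac]
  have hfin : Set.Finite {z : Fin 2 → K | (pmap G)^[k] z = z} := by
    refine Set.Finite.subset (s := {z : Fin 2 → K | ∀ i, eval z (pit G k i - X i) = 0}) hfix ?_
    intro z hz i
    rw [map_sub, eval_X, sub_eq_zero]
    have : pmap (pit G k) z = z := by rw [hTk]; exact hz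
    exact congrFun this i
  let s : Finset K := (Finset.univ.biUnion fun i => (G i).support.image fun m => coeff m (G i)) ∪
    (hfin.toFinset.biUnion fun z => Finset.univ.image z)
  obtain ⟨m, hm, hD, hs⟩ := exists_q p hp halg s ((G 0).totalDegree + (G 1).totalDegree)
  set q := p ^ m with hq
  have hcoeff : ∀ i, map (iterateFrobenius K p m) (G i) = G i := by
    intro i
    ext n
    rw [coeff_map, iterateFrobenius_def]
    by_cases hn : coeff n (G i) = 0
    · rw [hn, zero_pow (pow_ne_zero _ hp.ne_zero)]
    · apply hs
      simp only [s, Finset.mem_union, Finset.mem_biUnion, Finset.mem_image]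
      exact Or.inl ⟨i, Finset.mem_univ _, n, mem_support_iff.mpr hn, rfl⟩
  have hfrob : ∀ z : Fin 2 → K, pmap G (fun i => z i ^ q) = fun i => (pmap G z i) ^ q := by
    intro z
    ext i
    simp only [pmap]
    have := map_eval (iterateFrobenius K p m) z (G i)
    rw [hcoeff] at this
    rw [iterateFrobenius_def] at this
    rw [this]
    rfl
  have hfixq : ∀ z : Fin 2 → K, (pmap G)^[k] z = z → (fun i => z i ^ q) = z := by
    intro z hz
    ext i
    apply hs
    simp only [s, Finset.mem_union, Finset.mem_biUnion, Finset.mem_image]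
    exact Or.inr ⟨z, by simpa using hz, i, Finset.mem_univ _, rfl⟩
  -- the points with `z ^ q = G z`
  let S := {z : Fin 2 → K // ∀ i, eval z (X i ^ q - G i) = 0}
  have hS : ∀ z : Fin 2 → K, (∀ i, eval z (X i ^ q - G i) = 0) ↔ (fun i => z i ^ q) = pmap G z := by
    intro z
    simp only [map_sub, map_pow, eval_X, sub_eq_zero, _root_.funext_iff, pmap]
  have hdeg : ∀ i, LowDeg q (G i) := by
    intro i
    refine (exists_lowDeg (G i)).mono ?_
    fin_cases i <;> simp <;> omega
  have hqK : (q : K) = 0 := by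
    rw [hq]; push_cast; rw [CharP.cast_eq_zero K p, zero_pow hm.ne']
  obtain ⟨hSfin, hScard⟩ : Finite S ∧ Nat.card S = _ := zeros (fun i => X i ^ q - G i) (by
    intro z _
    rw [RingHom.map_det]
    have : ((eval z).mapMatrix (Matrix.of fun i j : Fin 2 => pderiv j (X i ^ q - G i))) = - jac G z := by
      ext i j
      simp [jac, hqK]
    rw [this, Matrix.det_neg, hG]
    simp)
  rw [dim_q q G hdeg _ fun i => rfl] at hScard
  have hstep : ∀ z : Fin 2 → K, (fun i => z i ^ q) = pmap G z →
      (fun i => (pmap G z) i ^ q) = pmap G (pmap G z) := by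
    intro z hz
    rw [← hfrob, hz]
  have hstepk : ∀ r, ∀ z : Fin 2 → K, (fun i => z i ^ q) = pmap G z →
      (fun i => ((pmap G)^[r] z) i ^ q) = pmap G ((pmap G)^[r] z) := by
    intro r
    induction r with
    | zero => intro z hz; exact hz
    | succ r ih =>
      intro z hz
      rw [Function.iterate_succ_apply']
      exact hstep _ (ih z hz)
  let τ : Function.End S := fun z => ⟨(pmap G)^[k] z.1, (hS _).2 (hstepk k z.1 ((hS _).1 z.2))⟩
  have hτ : ∀ r : ℕ, ∀ z : S, ((τ ^ r) z).1 = ((pmap G)^[k])^[r] z.1 := by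
    intro r
    induction r with
    | zero => intro z; rfl
    | succ r ih =>
      intro z
      rw [pow_succ', Function.iterate_succ_apply', ← ih]
      rfl
  have := Fintype.ofFinite S
  have : Fact l.Prime := ⟨hl⟩
  have hmod := Equiv.Perm.card_fixedPoints_modEq (f := τ) (p := l) (n := 1) (by
    rw [pow_one]
    funext z
    apply Subtype.ext
    rw [hτ, hkl]
    rfl)
  have hempty : IsEmpty (Function.fixedPoints τ) := by
    constructor
    rintro ⟨z, hz⟩
    have h1 : (pmap G)^[k] z.1 = z.1 := congrArg Subtype.val hz
    have h2 := (hS _).1 z.2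
    rw [hfixq _ h1] at h2
    exact hno z.1 h2.symm
  rw [Fintype.card_eq_zero (α := Function.fixedPoints τ), ← Nat.card_eq_fintype_card, hScard, hq] at hmod
  have hdvd : l ∣ p := by
    have := (Nat.modEq_zero_iff_dvd).1 hmod
    exact hl.dvd_of_dvd_pow (hl.dvd_of_dvd_pow this)
  rw [(Nat.prime_dvd_prime_iff_eq hl hp).1 hdvd] at hlK
  exact hlK (CharP.cast_eq_zero K p)

lemma jacobson_int : IsJacobsonRing ℤ := by
  rw [isJacobsonRing_iff_prime_eq]
  intro P hP
  by_cases h : P = ⊥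
  · subst h
    rw [eq_bot_iff]
    intro x hx
    rw [Ideal.mem_bot]
    by_contra hx0
    obtain ⟨p, hp, hpp⟩ := Nat.exists_infinite_primes (x.natAbs + 1)
    have hprime : Prime (p : ℤ) := Nat.prime_iff_prime_int.mp hpp
    have hmax : (Ideal.span {(p : ℤ)}).IsMaximal :=
      PrincipalIdealRing.isMaximal_of_irreducible hprime.irreducible
    have hmem : x ∈ Ideal.span {(p : ℤ)} := by
      rw [Ideal.jacobson, Ideal.mem_sInf] at hx
      exact hx ⟨bot_le, hmax⟩
    rw [Ideal.mem_span_singleton] at hmem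
    have := Int.le_of_dvd (by positivity) ((dvd_abs _ _).mpr hmem)
    rw [Int.abs_eq_natAbs] at this
    omega
  · have := hP.isMaximal h
    exact Ideal.jacobson_eq_self_of_isMaximal

lemma exists_hom_algClosed (R : Type) [CommRing R] [Nontrivial R] [Algebra.FiniteType ℤ R] :
    ∃ (p : ℕ) (_ : p.Prime) (K : Type) (_ : Field K) (_ : IsAlgClosed K) (_ : CharP K p) (_ : R →+* K),
      ∀ a : K, ∃ m, 0 < m ∧ a ^ (p ^ m) = a := by
  obtain ⟨M, hM⟩ := Ideal.exists_maximal R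
  let k := R ⧸ M
  let : Field k := Ideal.Quotient.field M
  have := jacobson_int
  have hft : Algebra.FiniteType ℤ k := inferInstanceAs (Algebra.FiniteType ℤ (R ⧸ M))
  have hfin : Module.Finite ℤ k := finite_of_finite_type_of_isJacobsonRing ℤ k
  obtain ⟨p, hchar⟩ := CharP.exists k
  have hp : p.Prime := by
    rcases CharP.char_is_prime_or_zero k p with h | h
    · exact h
    · subst h
      have : CharZero k := CharP.charP_to_charZero k
      exact absurd (isField_of_isIntegral_of_isField (R := ℤ) (S := k)
        (algebraMap ℤ k).injective_int (Field.toIsField k)) Int.not_isField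
  have : Fact p.Prime := ⟨hp⟩
  let : Algebra (ZMod p) k := ZMod.algebra k p
  have : IsScalarTower ℤ (ZMod p) k := IsScalarTower.of_algebraMap_eq' (RingHom.ext_int _ _)
  have : Module.Finite (ZMod p) k := Module.Finite.of_restrictScalars_finite ℤ (ZMod p) k
  have : Finite k := Module.finite_of_finite (ZMod p)
  have hK : CharP (AlgebraicClosure k) p := charP_of_injective_algebraMap (algebraMap k _).injective p
  refine ⟨p, hp, AlgebraicClosure k, inferInstance, inferInstance, hK,
    (algebraMap k (AlgebraicClosure k)).comp (Ideal.Quotient.mk M), ?_⟩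
  intro a
  have haint : IsIntegral k a := Algebra.IsIntegral.isIntegral a
  have := IntermediateField.adjoin.finiteDimensional haint
  have : Finite (IntermediateField.adjoin k {a}) := Module.finite_of_finite k
  have := Fintype.ofFinite (IntermediateField.adjoin k {a})
  have hc : CharP (IntermediateField.adjoin k {a}) p :=
    charP_of_injective_algebraMap (algebraMap k _).injective p
  obtain ⟨n, -, hn⟩ := FiniteField.card (IntermediateField.adjoin k {a}) p
  refine ⟨n, n.pos, ?_⟩
  have := FiniteField.pow_card (IntermediateField.AdjoinSimple.gen k a)
  rw [hn] at this
  simpa using congrArg (algebraMap _ (AlgebraicClosure k)) this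

lemma map_pit {R S : Type*} [CommRing R] [CommRing S] (f : R →+* S)
    (G : Fin 2 → MvPolynomial (Fin 2) R) (k : ℕ) (i : Fin 2) :
    map f (pit G k i) = pit (fun i => map f (G i)) k i := by
  induction k generalizing i with
  | zero => simp [pit]
  | succ k ih =>
    simp only [pit]
    rw [map_bind₁]
    congr 1
    congr 1
    funext j
    exact ih j

/-- Lemma 9: let `Q : ℂ² → ℂ²` be a polynomial map with `J(Q) ≡ 1` and of finite order.
Then `Q` has a fixed point. -/
theorem fixed_point_of_finite_order
    (G : Fin 2 → MvPolynomial (Fin 2) ℂ)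
    (hJ : (Matrix.of fun i j : Fin 2 => MvPolynomial.pderiv j (G i)).det = 1)
    (hord : ∃ t : ℕ, 1 ≤ t ∧
      (fun z : Fin 2 → ℂ => fun i => eval z (G i))^[t] = id) :
    ∃ z : Fin 2 → ℂ, (fun i => eval z (G i)) = z := by
  classical
  by_contra hno
  obtain ⟨t, ht, hord⟩ := hord
  change (pmap G)^[t] = id at hord
  have hpit : pit G t = X := by
    ext1 i
    apply MvPolynomial.funext
    intro w
    have := congrFun (pmap_pit G t w) i
    rw [hord] at this
    simpa [pmap] using this
  have htop : Ideal.span {G 0 - X 0, G 1 - X 1} = ⊤ := by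
    by_contra hne
    obtain ⟨M, hM, hle⟩ := Ideal.exists_le_maximal _ hne
    obtain ⟨z, hz⟩ := isMaximal_iff_eq_vanishingIdeal_singleton.mp hM
    have key : ∀ p ∈ M, eval z p = 0 := by
      intro p hp
      rw [hz, mem_vanishingIdeal_singleton_iff] at hp
      exact hp
    apply hno
    refine ⟨z, ?_⟩
    have h0 := key _ (hle (Ideal.subset_span (Set.mem_insert _ _)))
    have h1 := key _ (hle (Ideal.subset_span (Set.mem_insert_of_mem _ rfl)))
    rw [map_sub, eval_X, sub_eq_zero] at h0 h1
    funext i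
    fin_cases i
    · exact h0
    · exact h1
  obtain ⟨a, b, hab⟩ := Ideal.mem_span_pair.1 ((Ideal.eq_top_iff_one _).1 htop)
  let s : Finset ℂ := ((G 0).coeffs ∪ (G 1).coeffs) ∪ (a.coeffs ∪ b.coeffs) ∪ {(t : ℂ)⁻¹}
  let R := Algebra.adjoin ℤ (s : Set ℂ)
  have hR : Algebra.FiniteType ℤ R := (Subalgebra.fg_iff_finiteType R).1 (Subalgebra.fg_adjoin_finset s)
  let ι : R →+* ℂ := algebraMap R ℂ
  have hι : Function.Injective ι := Subtype.val_injective
  have hsR : ∀ x ∈ s, x ∈ Set.range ι := fun x hx => ⟨⟨x, Algebra.subset_adjoin hx⟩, rfl⟩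
  have hlift : ∀ P : MvPolynomial (Fin 2) ℂ, P.coeffs ⊆ s → ∃ P', map ι P' = P := by
    intro P hP
    have : P ∈ Set.range (map ι) := mem_range_map_iff_coeffs_subset.2 fun x hx => hsR x (hP hx)
    exact this
  obtain ⟨g0, hg0⟩ := hlift (G 0) fun x hx => by simp only [s, Finset.mem_union]; tauto
  obtain ⟨g1, hg1⟩ := hlift (G 1) fun x hx => by simp only [s, Finset.mem_union]; tauto
  obtain ⟨a', ha'⟩ := hlift a fun x hx => by simp only [s, Finset.mem_union]; tauto
  obtain ⟨b', hb'⟩ := hlift b fun x hx => by simp only [s, Finset.mem_union]; tauto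
  obtain ⟨r, hr⟩ := hsR (t : ℂ)⁻¹ (by simp [s])
  let g : Fin 2 → MvPolynomial (Fin 2) R := ![g0, g1]
  have hg : (fun i => map ι (g i)) = G := by
    funext i
    fin_cases i
    · exact hg0
    · exact hg1
  have hinj := map_injective (σ := Fin 2) ι hι
  have hgab : a' * (g 0 - X 0) + b' * (g 1 - X 1) = 1 := by
    apply hinj
    have e0 : map ι (g 0) = G 0 := hg0
    have e1 : map ι (g 1) = G 1 := hg1
    simp only [map_add, map_mul, map_sub, map_X, map_one, ha', hb', e0, e1]
    exact hab
  have hgJ : (Matrix.of fun i j : Fin 2 => pderiv j (g i)).det = 1 := by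
    apply hinj
    rw [RingHom.map_det, map_one, ← hJ, ← hg]
    congr 1
    ext1 i j
    simp [pderiv_map]
  have hgt : pit g t = X := by
    funext i
    apply hinj
    rw [map_pit, hg, hpit, map_X]
  have hrt : (t : R) * r = 1 := by
    apply hι
    rw [map_mul, map_natCast, hr, map_one, mul_inv_cancel₀]
    exact_mod_cast (by omega : t ≠ 0)
  obtain ⟨p, hp, K, _, _, _, ψ, halg⟩ := exists_hom_algClosed R
  have hJK : ∀ z, (jac (fun i => map ψ (g i)) z).det = 1 := by
    intro z
    have h1 := congrArg (fun P => eval z (map ψ P)) hgJ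
    simp only [RingHom.map_det, map_one] at h1
    rw [← h1]
    congr 1
    ext i j
    simp [jac, pderiv_map]
  have htK : (t : K) ≠ 0 := by
    intro h0
    have := congrArg ψ hrt
    rw [map_mul, map_natCast, h0, zero_mul, map_one] at this
    exact zero_ne_one this
  have hoK : (pmap (fun i => map ψ (g i)))^[t] = id := by
    funext w
    rw [← pmap_pit]
    funext i
    simp only [pmap]
    rw [← map_pit, hgt]
    simp
  obtain ⟨z, hz⟩ := main_K p hp halg (fun i => map ψ (g i)) hJK t htK hoK
  have h1 := congrArg (fun P => eval z (map ψ P)) hgab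
  have e : ∀ i, eval z (map ψ (g i)) = z i := fun i => congrFun hz i
  simp [e] at h1
end

section
/- Let P, Q : ℂ² → ℂ² be polynomial maps with J(P) identically equal to 1 and P ∘ Q = P. Then Q is the identity map. -/
open MvPolynomial

namespace CompSelf

/-- Chain rule for polynomial substitution in two variables. -/
lemma chain_rule {K : Type*} [CommRing K] (F : Fin 2 → MvPolynomial (Fin 2) K) (j : Fin 2)
    (H : MvPolynomial (Fin 2) K) :
    pderiv j (aeval F H) = aeval F (pderiv 0 H) * pderiv j (F 0)
      + aeval F (pderiv 1 H) * pderiv j (F 1) := by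
  induction H using MvPolynomial.induction_on with
  | C a => simp [MvPolynomial.algebraMap_eq]
  | add p q hp hq => simp only [map_add, hp, hq]; ring
  | mul_X p i hp =>
    simp only [map_mul, aeval_X, pderiv_mul, hp, map_add, pderiv_X]
    fin_cases i <;> simp <;> ring

lemma jac_indep (F : Fin 2 → MvPolynomial (Fin 2) ℂ)
    (hJ : pderiv 0 (F 0) * pderiv 1 (F 1) - pderiv 1 (F 0) * pderiv 0 (F 1) = 1) (n : ℕ) :
    ∀ H : MvPolynomial (Fin 2) ℂ, (∀ m : Fin 2 →₀ ℕ, n ≤ m 0 + m 1 → coeff m H = 0) →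
      aeval F H = 0 → H = 0 := by
  induction n with
  | zero => intro H h _; ext m; simpa using h m (Nat.zero_le _)
  | succ n ih =>
    intro H h h0
    have e0 := chain_rule F 0 H
    have e1 := chain_rule F 1 H
    rw [h0, map_zero] at e0 e1
    have hd : ∀ i, pderiv i H = 0 := by
      intro i
      apply ih
      · intro m hm
        rw [coeff_pderiv, h, zero_mul]
        fin_cases i <;> simp <;> omega
      · fin_cases i
        · show aeval F (pderiv 0 H) = 0
          linear_combination (-aeval F (pderiv 0 H)) * hJ - pderiv 1 (F 1) * e0
            + pderiv 0 (F 1) * e1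
        · show aeval F (pderiv 1 H) = 0
          linear_combination (-aeval F (pderiv 1 H)) * hJ + pderiv 1 (F 0) * e0
            - pderiv 0 (F 0) * e1
    have hC : H = C (coeff 0 H) := by
      ext m
      by_cases hm : m = 0
      · subst hm; simp
      · rw [coeff_C, if_neg (Ne.symm hm)]
        obtain ⟨i, hi⟩ := Finsupp.ne_iff.mp hm
        have := coeff_pderiv (i := i) H (m - Finsupp.single i 1)
        rw [hd, coeff_zero, tsub_add_cancel_of_le] at this
        · rcases mul_eq_zero.mp this.symm with h | h
          · exact h
          · exact absurd h (Nat.cast_add_one_ne_zero _)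
        · rw [Finsupp.single_le_iff]
          exact Nat.one_le_iff_ne_zero.mpr hi
    rw [hC, aeval_C, MvPolynomial.algebraMap_eq] at h0
    rw [hC, h0]

/-- First order Taylor expansion modulo the square of the displacement ideal. -/
lemma taylor {K : Type*} [CommRing K]
    (φ : MvPolynomial (Fin 2) K →ₐ[K] MvPolynomial (Fin 2) K)
    (I : Ideal (MvPolynomial (Fin 2) K)) (hI : ∀ i, φ (X i) - X i ∈ I)
    (f : MvPolynomial (Fin 2) K) :
    φ f - f ∈ I ∧ φ f - f - (pderiv 0 f * (φ (X 0) - X 0) + pderiv 1 f * (φ (X 1) - X 1)) ∈ I * I := by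
  induction f using MvPolynomial.induction_on with
  | C a =>
    have : φ (C a) = C a := φ.commutes a
    simp [this]
  | add p q hp hq =>
    refine ⟨?_, ?_⟩
    · have := I.add_mem hp.1 hq.1
      convert this using 1
      simp only [map_add]; ring
    · have := (I * I).add_mem hp.2 hq.2
      convert this using 1
      simp only [map_add]; ring
  | mul_X p i hp =>
    refine ⟨?_, ?_⟩
    · have := I.add_mem (I.mul_mem_left (φ (X i)) hp.1) (I.mul_mem_left p (hI i))
      convert this using 1
      simp only [map_mul]; ring
    · have := (I * I).add_mem ((I * I).mul_mem_left (X i) hp.2) (Ideal.mul_mem_mul hp.1 (hI i))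
      convert this using 1
      simp only [map_mul, pderiv_mul, pderiv_X]
      fin_cases i <;> simp <;> ring

/-- The displacement ideal is trivial or everything. -/
lemma dichotomy (F : Fin 2 → MvPolynomial (Fin 2) ℂ)
    (hJ : pderiv 0 (F 0) * pderiv 1 (F 1) - pderiv 1 (F 0) * pderiv 0 (F 1) = 1)
    (φ : MvPolynomial (Fin 2) ℂ →ₐ[ℂ] MvPolynomial (Fin 2) ℂ) (hφ : ∀ i, φ (F i) = F i)
    (hne : φ ≠ 1) :
    Ideal.span (Set.range fun i => φ (X i) - X i) = ⊤ := by
  set I := Ideal.span (Set.range fun i => φ (X i) - X i) with hIdef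
  have hI : ∀ i, φ (X i) - X i ∈ I := fun i => Ideal.subset_span ⟨i, rfl⟩
  have h0 := (taylor φ I hI (F 0)).2
  have h1 := (taylor φ I hI (F 1)).2
  rw [hφ] at h0 h1
  have hid : IsIdempotentElem I := by
    apply le_antisymm Ideal.mul_le_left
    rw [hIdef, Ideal.span_le, ← hIdef]
    rintro _ ⟨i, rfl⟩
    fin_cases i
    · have := (I * I).sub_mem ((I * I).mul_mem_left (pderiv 1 (F 0)) h1)
        ((I * I).mul_mem_left (pderiv 1 (F 1)) h0)
      show φ (X 0) - X 0 ∈ I * I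
      convert this using 1
      linear_combination (-(φ (X 0) - X 0)) * hJ
    · have := (I * I).sub_mem ((I * I).mul_mem_left (pderiv 0 (F 1)) h0)
        ((I * I).mul_mem_left (pderiv 0 (F 0)) h1)
      show φ (X 1) - X 1 ∈ I * I
      convert this using 1
      linear_combination (-(φ (X 1) - X 1)) * hJ
  rcases (Ideal.isIdempotentElem_iff_eq_bot_or_top I
    (IsNoetherian.noetherian I)).mp hid with h | h
  · exfalso
    apply hne
    apply MvPolynomial.algHom_ext
    intro i
    have := hI i
    rw [h, Ideal.mem_bot, sub_eq_zero] at this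
    simpa using this
  · exact h

lemma pow_fix (F : Fin 2 → MvPolynomial (Fin 2) ℂ)
    (φ : MvPolynomial (Fin 2) ℂ →ₐ[ℂ] MvPolynomial (Fin 2) ℂ) (hφ : ∀ i, φ (F i) = F i)
    (n : ℕ) : ∀ i, (φ ^ n) (F i) = F i := by
  induction n with
  | zero => intro i; rfl
  | succ n ih => intro i; rw [pow_succ, AlgHom.mul_apply, hφ, ih]

lemma finite_orbit (F : Fin 2 → MvPolynomial (Fin 2) ℂ)
    (hJ : pderiv 0 (F 0) * pderiv 1 (F 1) - pderiv 1 (F 0) * pderiv 0 (F 1) = 1)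
    (s : MvPolynomial (Fin 2) ℂ) :
    {t | ∃ φ : MvPolynomial (Fin 2) ℂ →ₐ[ℂ] MvPolynomial (Fin 2) ℂ,
      (∀ i, φ (F i) = F i) ∧ t = φ s}.Finite := by
  have hind : AlgebraicIndependent ℂ F := by
    rw [algebraicIndependent_iff]
    intro H hH
    refine jac_indep F hJ (H.totalDegree + 1) H ?_ hH
    intro m hm
    apply coeff_eq_zero_of_totalDegree_lt
    rw [Finset.sum_subset (Finset.subset_univ m.support)
      (fun i _ hi => Finsupp.notMem_support_iff.mp hi), Fin.sum_univ_two]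
    omega
  have hb : IsTranscendenceBasis ℂ F :=
    hind.isTranscendenceBasis_of_trdeg_le_of_finite (by simp [MvPolynomial.trdeg_of_isDomain])
  have halg := hb.isAlgebraic
  obtain ⟨p, hp0, hp⟩ := halg.isAlgebraic s
  set q := p.map (algebraMap (Algebra.adjoin ℂ (Set.range F)) (MvPolynomial (Fin 2) ℂ)) with hq
  have hq0 : q ≠ 0 := by
    rw [hq, Polynomial.map_ne_zero_iff]
    · exact hp0
    · exact Subtype.val_injective
  have hqs : q.eval s = 0 := by
    rw [hq, Polynomial.eval_map_algebraMap]; exact hp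
  refine (q.roots.toFinset.finite_toSet).subset ?_
  rintro _ ⟨φ, hφ, rfl⟩
  simp only [Finset.mem_coe, Multiset.mem_toFinset, Polynomial.mem_roots hq0, Polynomial.IsRoot.def]
  have hmap : q.map (φ : MvPolynomial (Fin 2) ℂ →+* MvPolynomial (Fin 2) ℂ) = q := by
    rw [hq, Polynomial.map_map]
    congr 1
    ext1 a
    obtain ⟨a, ha⟩ := a
    show φ a = a
    have : Algebra.adjoin ℂ (Set.range F) ≤ AlgHom.equalizer φ (AlgHom.id ℂ _) := by
      rw [Algebra.adjoin_le_iff]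
      rintro _ ⟨i, rfl⟩
      exact hφ i
    exact this ha
  have := Polynomial.eval_map_apply (p := q)
    (φ : MvPolynomial (Fin 2) ℂ →+* MvPolynomial (Fin 2) ℂ) s
  rw [hmap, hqs] at this
  simpa using this

lemma finite_order (F : Fin 2 → MvPolynomial (Fin 2) ℂ)
    (hJ : pderiv 0 (F 0) * pderiv 1 (F 1) - pderiv 1 (F 0) * pderiv 0 (F 1) = 1)
    (φ : MvPolynomial (Fin 2) ℂ →ₐ[ℂ] MvPolynomial (Fin 2) ℂ) (hφ : ∀ i, φ (F i) = F i) :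
    IsOfFinOrder φ := by
  have hfin : (Set.range fun n : ℕ => (fun i => (φ ^ n) (X i) : Fin 2 → _)).Finite := by
    refine (Set.Finite.pi' (fun i : Fin 2 => finite_orbit F hJ (X i))).subset ?_
    rintro _ ⟨n, rfl⟩ i
    exact ⟨φ ^ n, pow_fix F φ hφ n, rfl⟩
  have hni : ¬ Function.Injective fun n : ℕ => (fun i => (φ ^ n) (X i) : Fin 2 → _) := by
    intro h
    exact Set.infinite_range_of_injective h hfin
  have : ∃ k d : ℕ, 0 < d ∧ φ ^ (k + d) = φ ^ k := by
    simp only [Function.Injective, not_forall] at hni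
    obtain ⟨a, b, hab, hne⟩ := hni
    have hab' : φ ^ a = φ ^ b := MvPolynomial.algHom_ext fun i => congrFun hab i
    rcases lt_or_gt_of_ne hne with h | h
    · exact ⟨a, b - a, by omega, by rw [hab']; congr 1; omega⟩
    · exact ⟨b, a - b, by omega, by rw [← hab']; congr 1; omega⟩
  obtain ⟨k, d, hd, hk⟩ := this
  have h1 : ∀ n, φ ^ (k + n + d) = φ ^ (k + n) := by
    intro n
    rw [show k + n + d = n + (k + d) by ring, pow_add, hk, ← pow_add, add_comm]
  have h2 : ∀ m n, φ ^ (k + n + m * d) = φ ^ (k + n) := by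
    intro m n
    induction m with
    | zero => simp
    | succ m ih =>
      rw [show k + n + (m + 1) * d = k + (n + m * d) + d by ring, h1, ← add_assoc, ih]
  have hN : k ≤ (k + 1) * d := by nlinarith
  obtain ⟨r, hr⟩ := Nat.exists_eq_add_of_le hN
  have hidem : φ ^ ((k + 1) * d) * φ ^ ((k + 1) * d) = φ ^ ((k + 1) * d) := by
    rw [← pow_add]
    nth_rewrite 1 [hr]
    rw [h2, ← hr]
  rw [isOfFinOrder_iff_pow_eq_one]
  refine ⟨(k + 1) * d, by positivity, ?_⟩
  set e := φ ^ ((k + 1) * d) with he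
  by_contra hne
  have htop := dichotomy F hJ e (pow_fix F φ hφ _) hne
  have hle : Ideal.span (Set.range fun i => e (X i) - X i) ≤
      RingHom.ker (e : MvPolynomial (Fin 2) ℂ →+* MvPolynomial (Fin 2) ℂ) := by
    rw [Ideal.span_le]
    rintro _ ⟨i, rfl⟩
    have := DFunLike.congr_fun hidem (X i)
    rw [AlgHom.mul_apply] at this
    simp [RingHom.mem_ker, this]
  rw [htop] at hle
  have := hle (Submodule.mem_top (x := (1 : MvPolynomial (Fin 2) ℂ)))
  simp [RingHom.mem_ker] at this

/-- Iterating a substitution commutes with a change of coefficients. -/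
lemma map_pow {A B : Type*} [CommRing A] [CommRing B] (f : A →+* B)
    (R : Fin 2 → MvPolynomial (Fin 2) A) (n : ℕ) (p : MvPolynomial (Fin 2) A) :
    map f (((aeval R : _ →ₐ[A] MvPolynomial (Fin 2) A) ^ n) p) =
      ((aeval (fun i => map f (R i)) : _ →ₐ[B] MvPolynomial (Fin 2) B) ^ n) (map f p) := by
  induction n generalizing p with
  | zero => rfl
  | succ n ih =>
    rw [pow_succ, pow_succ, AlgHom.mul_apply, AlgHom.mul_apply, ih]
    congr 1
    exact map_bind₁ f R p

lemma eval_pow {k : Type*} [CommRing k] (R : Fin 2 → MvPolynomial (Fin 2) k) (n : ℕ)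
    (z : Fin 2 → k) (p : MvPolynomial (Fin 2) k) :
    eval z (((aeval R : _ →ₐ[k] MvPolynomial (Fin 2) k) ^ n) p) =
      eval ((fun z : Fin 2 → k => fun i => eval z (R i))^[n] z) p := by
  induction n generalizing p with
  | zero => rfl
  | succ n ih =>
    rw [pow_succ, AlgHom.mul_apply, ih, Function.iterate_succ_apply']
    generalize (fun z : Fin 2 → k => fun i => eval z (R i))^[n] z = w
    have : (eval w).comp (aeval R : _ →ₐ[k] MvPolynomial (Fin 2) k).toRingHom
        = eval (fun i => eval w (R i)) := by
      ext i <;> simp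
    exact RingHom.congr_fun this p

/-- No fixed-point-free substitution of prime order over a finite field of other characteristic. -/
lemma finite_field_case {k : Type*} [Field k] [Finite k] (p : ℕ) (hp : p.Prime)
    (hpk : (p : k) ≠ 0) (R a : Fin 2 → MvPolynomial (Fin 2) k)
    (hR : ∀ i, ((aeval R : _ →ₐ[k] MvPolynomial (Fin 2) k) ^ p) (X i) = X i)
    (ha : a 0 * (R 0 - X 0) + a 1 * (R 1 - X 1) = 1) : False := by
  classical
  have := Fintype.ofFinite k
  have : Fact p.Prime := ⟨hp⟩
  let r : Function.End (Fin 2 → k) := fun z i => eval z (R i)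
  have hr : r ^ p ^ 1 = 1 := by
    rw [pow_one]
    funext z i
    have := eval_pow R p z (X i)
    rw [hR, eval_X, eval_X] at this
    have hpow : ∀ n : ℕ, (r ^ n) z = (fun z : Fin 2 → k => fun i => eval z (R i))^[n] z := by
      intro n
      induction n with
      | zero => rfl
      | succ n ih =>
        rw [pow_succ', Function.iterate_succ_apply', ← ih]
        rfl
    rw [hpow]
    exact this.symm
  have hcard := Equiv.Perm.card_fixedPoints_modEq hr
  have hemp : IsEmpty (Function.fixedPoints r) := by
    refine ⟨fun ⟨z, hz⟩ => ?_⟩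
    have h : ∀ i, eval z (R i) = z i := fun i => congrFun hz i
    have := congrArg (eval z) ha
    simp [h] at this
  have hz : Fintype.card (Function.fixedPoints r) = 0 := Fintype.card_eq_zero_iff.mpr hemp
  rw [hz, Nat.modEq_zero_iff_dvd, Fintype.card_fun, Fintype.card_fin] at hcard
  have hd := hp.dvd_of_dvd_pow hcard
  obtain ⟨c, hc⟩ := hd
  have h0 : ((Fintype.card k : ℕ) : k) = 0 := FiniteField.cast_card_eq_zero k
  obtain ⟨n, hq, hn⟩ := FiniteField.card k (ringChar k)
  have hpd : p ∣ ringChar k := hp.dvd_of_dvd_pow (hn ▸ Dvd.intro c hc.symm)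
  rw [(Nat.prime_dvd_prime_iff_eq hp hq).mp hpd] at hpk
  exact hpk (ringChar.Nat.cast_ringChar)

lemma int_jacobson : IsJacobsonRing ℤ := by
  rw [isJacobsonRing_iff_prime_eq]
  intro P hP
  by_cases h : P = ⊥
  · subst h
    rw [eq_bot_iff]
    intro x hx
    have h1 := Ideal.mem_jacobson_bot.mp hx x
    rw [Int.isUnit_iff] at h1
    rw [Ideal.mem_bot]
    rcases h1 with h1 | h1 <;> nlinarith
  · have : P.IsMaximal := hP.isMaximal h
    exact Ideal.jacobson_eq_self_of_isMaximal

lemma finite_residue {A : Type*} [CommRing A] [inst : Algebra ℤ A] (hA : Algebra.FiniteType ℤ A)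
    (k : Type*) [Field k] (g : A →+* k) (hg : Function.Surjective g) : Finite k := by
  have : Algebra.FiniteType ℤ k :=
    Algebra.FiniteType.of_surjective
      ({ g with commutes' := fun n => by simp } : A →ₐ[ℤ] k) hg
  have hjac : IsJacobsonRing ℤ := int_jacobson
  have hfin : Module.Finite ℤ k := finite_of_finite_type_of_isJacobsonRing ℤ k
  have hintegral : Algebra.IsIntegral ℤ k := inferInstance
  have hchar : ringChar k ≠ 0 := by
    intro h
    have : CharP k 0 := h ▸ ringChar.charP k
    have : CharZero k := CharP.charP_to_charZero k
    have : IsField ℤ := isField_of_isIntegral_of_isField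
      (R := ℤ) (S := k) (RingHom.injective_int (algebraMap ℤ k)) (Field.toIsField k)
    exact Int.not_isField this
  have : NeZero (ringChar k) := ⟨hchar⟩
  let : Algebra (ZMod (ringChar k)) k := ZMod.algebra k (ringChar k)
  have : Module.Finite (ZMod (ringChar k)) k := Module.Finite.of_restrictScalars_finite ℤ _ _
  exact Module.finite_of_finite (ZMod (ringChar k))

lemma no_prime_order (R a : Fin 2 → MvPolynomial (Fin 2) ℂ) (p : ℕ) (hp : p.Prime)
    (hR : ∀ i, ((aeval R : _ →ₐ[ℂ] MvPolynomial (Fin 2) ℂ) ^ p) (X i) = X i)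
    (ha : a 0 * (R 0 - X 0) + a 1 * (R 1 - X 1) = 1) : False := by
  classical
  let S : Finset ℂ := {(p : ℂ)⁻¹} ∪ (Finset.univ.biUnion fun i => (R i).coeffs)
    ∪ (Finset.univ.biUnion fun i => (a i).coeffs)
  let A := Algebra.adjoin ℤ (S : Set ℂ)
  have hS : ∀ x ∈ S, x ∈ A := fun x hx => Algebra.subset_adjoin hx
  have hft : Algebra.FiniteType ℤ A :=
    (Subalgebra.fg_iff_finiteType _).mp (Subalgebra.fg_adjoin_finset S)
  let f : A →+* ℂ := A.val.toRingHom
  have hf : Function.Injective f := Subtype.val_injective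
  have hlift : ∀ q : MvPolynomial (Fin 2) ℂ, q.coeffs ⊆ S → ∃ q', map f q' = q := by
    intro q hq
    have := (mem_range_map_iff_coeffs_subset (f := f) (x := q)).mpr
      (fun x hx => ⟨⟨x, hS x (hq hx)⟩, rfl⟩)
    exact this
  have hRS : ∀ i, (R i).coeffs ⊆ S := fun i x hx => by
    simp only [S, Finset.mem_union, Finset.mem_biUnion]
    exact Or.inl (Or.inr ⟨i, Finset.mem_univ _, hx⟩)
  have haS : ∀ i, (a i).coeffs ⊆ S := fun i x hx => by
    simp only [S, Finset.mem_union, Finset.mem_biUnion]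
    exact Or.inr ⟨i, Finset.mem_univ _, hx⟩
  choose R' hR' using fun i => hlift (R i) (hRS i)
  choose a' ha' using fun i => hlift (a i) (haS i)
  have hpS : (p : ℂ)⁻¹ ∈ A := hS _ (by simp [S])
  have hpA : (p : A) * ⟨(p : ℂ)⁻¹, hpS⟩ = 1 := by
    apply hf
    rw [map_mul, map_natCast, map_one]
    exact mul_inv_cancel₀ (by exact_mod_cast hp.ne_zero)
  have hmf : Function.Injective (map f : MvPolynomial (Fin 2) A → _) := map_injective f hf
  have hRA : ∀ i, ((aeval R' : _ →ₐ[A] MvPolynomial (Fin 2) A) ^ p) (X i) = X i := by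
    intro i
    apply hmf
    rw [map_pow, map_X]
    simp only [hR']
    exact hR i
  have haA : a' 0 * (R' 0 - X 0) + a' 1 * (R' 1 - X 1) = 1 := by
    apply hmf
    simpa [hR', ha'] using ha
  obtain ⟨m, hm⟩ := Ideal.exists_maximal A
  let : Field (A ⧸ m) := Ideal.Quotient.field m
  have : Finite (A ⧸ m) :=
    finite_residue hft (A ⧸ m) (Ideal.Quotient.mk m) Ideal.Quotient.mk_surjective
  let g : A →+* A ⧸ m := Ideal.Quotient.mk m
  refine finite_field_case (k := A ⧸ m) p hp ?_ (fun i => map g (R' i)) (fun i => map g (a' i)) ?_ ?_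
  · intro h0
    have := congrArg g hpA
    rw [map_mul, map_natCast, map_one, h0, zero_mul] at this
    exact zero_ne_one this
  · intro i
    have := map_pow g R' p (X i)
    rw [hRA, map_X] at this
    exact this.symm
  · have := congrArg (map g) haA
    simpa using this

end CompSelf

/-- Let `P, Q : ℂ² → ℂ²` be polynomial maps with `J(P) ≡ 1` and `P ∘ Q = P`.
Then `Q` is the identity map. -/
theorem comp_eq_self_implies_identity
    (F G : Fin 2 → MvPolynomial (Fin 2) ℂ)
    (hJ : (Matrix.of fun i j : Fin 2 => MvPolynomial.pderiv j (F i)).det = 1)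
    (hPQ : ∀ z : Fin 2 → ℂ,
      (fun i => eval (fun j => eval z (G j)) (F i)) = fun i => eval z (F i)) :
    ∀ z : Fin 2 → ℂ, (fun i => eval z (G i)) = z := by
  have hJ' : pderiv 0 (F 0) * pderiv 1 (F 1) - pderiv 1 (F 0) * pderiv 0 (F 1) = 1 := by
    rw [Matrix.det_fin_two] at hJ
    simpa using hJ
  set φ : MvPolynomial (Fin 2) ℂ →ₐ[ℂ] MvPolynomial (Fin 2) ℂ := aeval G with hφdef
  have hφ : ∀ i, φ (F i) = F i := by
    intro i
    apply MvPolynomial.funext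
    intro z
    have h := CompSelf.eval_pow G 1 z (F i)
    rw [pow_one, Function.iterate_one] at h
    exact h.trans (congrFun (hPQ z) i)
  have hone : φ = 1 := by
    by_contra hne
    have hfo := CompSelf.finite_order F hJ' φ hφ
    have hord : orderOf φ ≠ 1 := fun h => hne (orderOf_eq_one_iff.mp h)
    obtain ⟨p, hp, c, hc⟩ := Nat.exists_prime_and_dvd hord
    have hpos : 0 < orderOf φ := hfo.orderOf_pos
    have hcpos : 0 < c := Nat.pos_of_ne_zero (by rintro rfl; omega)
    have hψne : φ ^ c ≠ 1 := by
      intro h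
      have := Nat.le_of_dvd hcpos (orderOf_dvd_of_pow_eq_one h)
      have := hp.two_le
      nlinarith
    have hψp : (φ ^ c) ^ p = 1 := by
      rw [← pow_mul, mul_comm, ← hc, pow_orderOf_eq_one]
    have htop := CompSelf.dichotomy F hJ' (φ ^ c) (CompSelf.pow_fix F φ hφ c) hψne
    have h1 : (1 : MvPolynomial (Fin 2) ℂ) ∈
        Ideal.span (Set.range fun i => (φ ^ c) (X i) - X i) := by rw [htop]; trivial
    rw [Ideal.mem_span_range_iff_exists_fun] at h1
    obtain ⟨a, ha⟩ := h1
    rw [Fin.sum_univ_two] at ha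
    refine CompSelf.no_prime_order (fun i => (φ ^ c) (X i)) a p hp ?_ ha
    intro i
    have he : (aeval fun i => (φ ^ c) (X i)) = φ ^ c := (aeval_unique (φ ^ c)).symm
    rw [he, hψp]
    rfl
  intro z
  funext i
  have := DFunLike.congr_fun hone (X i)
  rw [hφdef, aeval_X] at this
  rw [this]
  simp
end
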